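/- arXiv:1405.0630 — 4 statements merged into one kernel-verified Lean document; each statement's English description precedes it below -/
import Mathlib

section
/- Let k be a field of characteristic zero, K = k(t), and let γ, c ∈ k[t] with deg γ = deg c, γ − c non-constant, and φ(x) = (x−γ)² + c. Assume c·φ(c) ≠ 0. Set s_φ = log₂(110 · deg γ / deg(γ−c)) + 3. If −φ(γ) is not a square in k[t] and φ^m(γ) is not a square in k[t] for every integer m with 2 ≤ m ≤ s_φ, then φ is stable, i.e. φ^n is irreducible over K for every n ≥ 1. -/
open Polynomial

section Capelli

open IntermediateField

variable {K : Type*} [Field K]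

theorem natDegree_vertexForm (a b : K) : ((X - C a) ^ 2 + C b : K[X]).natDegree = 2 := by
  rw [natDegree_add_C, natDegree_pow, natDegree_X_sub_C]

theorem monic_vertexForm (a b : K) : ((X - C a) ^ 2 + C b : K[X]).Monic :=
  ((monic_X_sub_C a).pow 2).add_of_left (by
    rw [degree_pow, degree_X_sub_C]
    exact degree_C_le.trans_lt (by decide))

/-- A vertex-form quadratic `(x - a)² + b` is irreducible as soon as `-b` is not a square. -/
theorem irreducible_vertexForm {a b : K} (h : ¬ IsSquare (-b)) :
    Irreducible ((X - C a) ^ 2 + C b : K[X]) := by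
  refine irreducible_of_degree_le_three_of_not_isRoot ?_ fun x hx => h ⟨x - a, ?_⟩
  · rw [natDegree_vertexForm]
    decide
  · simp only [IsRoot.def, eval_add, eval_pow, eval_sub, eval_X, eval_C] at hx
    linear_combination -hx

/-- The norm of `c - pb.gen` is the value at `c` of the minimal polynomial of `pb.gen`. -/
theorem norm_algebraMap_sub_gen {L : Type*} [Field L] [Algebra K L] (pb : PowerBasis K L) (c : K) :
    Algebra.norm K (algebraMap K L c - pb.gen) = (minpoly K pb.gen).eval c := by
  rw [Algebra.norm_eq_matrix_det pb.basis, map_sub, ← charpoly_leftMulMatrix, Matrix.eval_charpoly,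
    AlgHom.commutes]
  rfl

/-- Capelli's criterion for precomposition with a vertex-form quadratic: irreducibility of a monic
`f` of even degree passes to `f ((x - a)² + b)` when `f b` is not a square. -/
theorem irreducible_comp_vertexForm {f : K[X]} (hfm : f.Monic) (hf : Irreducible f)
    (heven : Even f.natDegree) {a b : K} (hb : ¬ IsSquare (f.eval b)) :
    Irreducible (f.comp ((X - C a) ^ 2 + C b)) := by
  refine irreducible_comp hfm (monic_vertexForm a b) hf fun E _ _ x hx => ?_
  have hint : IsIntegral K x := by
    by_contra h
    exact hfm.ne_zero (hx ▸ minpoly.eq_zero h)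
  rw [Polynomial.map_add, Polynomial.map_pow, Polynomial.map_sub, map_X, map_C, map_C, add_sub_assoc,
    ← C_sub]
  refine irreducible_vertexForm ?_
  rintro ⟨r, hr⟩
  refine hb ⟨Algebra.norm K r, ?_⟩
  have hgen : (adjoin.powerBasis hint).gen = AdjoinSimple.gen K x := adjoin.powerBasis_gen hint
  have hnorm := norm_algebraMap_sub_gen (adjoin.powerBasis hint) b
  rw [hgen, minpoly_gen, hx] at hnorm
  have hfin : Module.finrank K K⟮x⟯ = f.natDegree := by rw [adjoin.finrank hint, hx]
  have hneg : algebraMap K K⟮x⟯ b - AdjoinSimple.gen K x = algebraMap K K⟮x⟯ (-1) * (r * r) := by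
    rw [← hr, map_neg, map_one]
    ring
  rw [← hnorm, hneg, map_mul, Algebra.norm_algebraMap, hfin, heven.neg_one_pow, one_mul, map_mul]

end Capelli

section Iterates

variable {K : Type*} [Field K]

theorem iterate_comp_monic_natDegree (a b : K) (n : ℕ) :
    ((fun p : K[X] => p.comp ((X - C a) ^ 2 + C b))^[n] X).Monic ∧
      ((fun p : K[X] => p.comp ((X - C a) ^ 2 + C b))^[n] X).natDegree = 2 ^ n := by
  have hdeg := natDegree_vertexForm a b
  induction n with
  | zero => exact ⟨monic_X, natDegree_X⟩
  | succ n ih =>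
    rw [Function.iterate_succ_apply']
    exact ⟨ih.1.comp (monic_vertexForm a b) (by omega), by rw [natDegree_comp, ih.2, hdeg, pow_succ]⟩

theorem eval_iterate_comp (φ : K[X]) (n : ℕ) (x : K) :
    ((fun p : K[X] => p.comp φ)^[n] X).eval x = (fun y => φ.eval y)^[n] x := by
  induction n generalizing x with
  | zero => simp
  | succ n ih => rw [Function.iterate_succ_apply', eval_comp, ih, Function.iterate_succ_apply]

/-- All iterates of `(x - a)² + b` are irreducible if `-b` and all further values of the critical
orbit are nonsquares. -/
theorem irreducible_iterate_vertexForm {a b : K} (h1 : ¬ IsSquare (-b))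
    (h : ∀ n : ℕ, 1 ≤ n → ¬ IsSquare ((fun y => (y - a) ^ 2 + b)^[n] b)) (n : ℕ) :
    Irreducible ((fun p : K[X] => p.comp ((X - C a) ^ 2 + C b))^[n] X) := by
  induction n with
  | zero => exact irreducible_X
  | succ n ih =>
    rw [Function.iterate_succ_apply']
    obtain ⟨hmonic, hdeg⟩ := iterate_comp_monic_natDegree a b n
    rcases Nat.eq_zero_or_pos n with rfl | hn
    · simpa using irreducible_vertexForm h1
    · refine irreducible_comp_vertexForm hmonic ih ?_ ?_
      · rw [hdeg]
        exact even_two.pow_of_ne_zero hn.ne'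
      · rw [eval_iterate_comp]
        simpa using h n hn

end Iterates

section Squares

/-- In an integrally closed domain, squares of the fraction field are squares. -/
theorem isSquare_of_isSquare_algebraMap {R F : Type*} [CommRing R] [IsDomain R]
    [IsIntegrallyClosed R] [Field F] [Algebra R F] [IsFractionRing R F] {r : R}
    (h : IsSquare (algebraMap R F r)) : IsSquare r := by
  obtain ⟨x, hx⟩ := h
  obtain ⟨y, rfl⟩ := IsIntegrallyClosed.exists_algebraMap_eq_of_isIntegral_pow (R := R) (x := x)
    two_pos (by rw [pow_two, ← hx]; exact isIntegral_algebraMap)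
  exact ⟨y, IsFractionRing.injective R F (by rw [hx, map_mul])⟩

variable {k : Type*} [Field k]

/-- If `W² + c` is a square with `c ≠ 0`, then `deg W ≤ deg c`. -/
theorem natDegree_le_of_isSquare_sq_add [CharZero k] {W c : k[X]} (hc : c ≠ 0) (h : IsSquare (W ^ 2 + c)) :
    W.natDegree ≤ c.natDegree := by
  obtain ⟨y, hy⟩ := h
  have hmul : (y - W) * (y + W) = c := by linear_combination -hy
  have h1 : y - W ≠ 0 := fun h0 => hc (by rw [← hmul, h0, zero_mul])
  have h2 : y + W ≠ 0 := fun h0 => hc (by rw [← hmul, h0, mul_zero])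
  have hadd := natDegree_mul h1 h2
  rw [hmul] at hadd
  have htwo : C (2 : k) * W = (y + W) - (y - W) := by
    rw [map_ofNat]
    ring
  have hW : W.natDegree = ((y + W) - (y - W)).natDegree := by
    rw [← htwo, natDegree_C_mul two_ne_zero]
  have := natDegree_sub_le (y + W) (y - W)
  omega

theorem natDegree_iterate_sub {γ c : k[X]} (hnc : (γ - c).natDegree ≠ 0) (n : ℕ) :
    ((fun a => (a - γ) ^ 2 + c)^[n] c - γ).natDegree = 2 ^ n * (γ - c).natDegree := by
  have hswap : (c - γ).natDegree = (γ - c).natDegree := natDegree_sub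
  induction n with
  | zero => simpa using hswap
  | succ n ih =>
    have hsq : (((fun a => (a - γ) ^ 2 + c)^[n] c - γ) ^ 2).natDegree
        = 2 ^ (n + 1) * (γ - c).natDegree := by
      rw [natDegree_pow, ih]
      ring
    rw [Function.iterate_succ_apply', add_sub_assoc, natDegree_add_eq_left_of_natDegree_lt, hsq]
    rw [hsq, hswap]
    have := Nat.one_lt_two_pow (n := n + 1) (by omega)
    nlinarith [Nat.pos_of_ne_zero hnc]

/-- Elements of the critical orbit are not squares once their degree is large enough. -/
theorem not_isSquare_iterate [CharZero k] {γ c : k[X]} (hnc : (γ - c).natDegree ≠ 0) (hc : c ≠ 0) {n : ℕ}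
    (hn : c.natDegree < 2 ^ n * (γ - c).natDegree) :
    ¬ IsSquare ((fun a => (a - γ) ^ 2 + c)^[n + 1] c) := by
  rw [Function.iterate_succ_apply']
  intro h
  have := natDegree_le_of_isSquare_sq_add hc h
  rw [natDegree_iterate_sub hnc] at this
  omega

end Squares

/-- Proposition 1 part 2 (stability test, `h(γ) = h(c)`, non-isotrivial): if `c·φ(c) ≠ 0`
and none of `-φ(γ)` and `φ^m(γ)` for `2 ≤ m ≤ s_φ := log₂(110·h(γ)/h(γ-c)) + 3` is a square
in `k[t]`, then `φ = (x-γ)²+c` is stable over `k(t)`. -/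
theorem stability_test_eq (k : Type*) [Field k] [CharZero k] (γ c : Polynomial k)
    (hdeg : γ.natDegree = c.natDegree)
    (hnc : (γ - c).natDegree ≠ 0)
    (hc : c * ((c - γ) ^ 2 + c) ≠ 0)
    (h1 : ¬ IsSquare (-((fun a => (a - γ) ^ 2 + c)^[1] γ)))
    (hm : ∀ m : ℕ, 2 ≤ m →
      (m : ℝ) ≤ Real.logb 2 (110 * (γ.natDegree : ℝ) / ((γ - c).natDegree : ℝ)) + 3 →
      ¬ IsSquare ((fun a => (a - γ) ^ 2 + c)^[m] γ))
    (φ : Polynomial (RatFunc k))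
    (hφ : φ = (X - C (algebraMap (Polynomial k) (RatFunc k) γ)) ^ 2
            + C (algebraMap (Polynomial k) (RatFunc k) c)) :
    ∀ n : ℕ, 1 ≤ n →
      Irreducible ((fun p => p.comp φ)^[n] (X : Polynomial (RatFunc k))) := by
  intro n _
  subst hφ
  have hstep (j : ℕ) : (fun a => (a - γ) ^ 2 + c)^[j + 1] γ = (fun a => (a - γ) ^ 2 + c)^[j] c := by
    simp [Function.iterate_succ_apply]
  refine irreducible_iterate_vertexForm (fun h => h1 ?_) (fun j hj h => ?_) n
  · rw [← map_neg] at h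
    simpa using isSquare_of_isSquare_algebraMap h
  have hsemi : Function.Semiconj (algebraMap k[X] (RatFunc k)) (fun a => (a - γ) ^ 2 + c)
      (fun y => (y - algebraMap k[X] (RatFunc k) γ) ^ 2 + algebraMap k[X] (RatFunc k) c) :=
    fun a => by simp
  rw [← hsemi.iterate_right j c] at h
  have hsq := isSquare_of_isSquare_algebraMap h
  obtain ⟨i, rfl⟩ : ∃ i, j = i + 1 := ⟨j - 1, by omega⟩
  refine hm (i + 1 + 1) (by omega) ?_ (by rwa [hstep])
  by_contra! hlt
  refine not_isSquare_iterate hnc (left_ne_zero_of_mul hc) ?_ hsq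
  have he : (0 : ℝ) < (γ - c).natDegree := by exact_mod_cast Nat.pos_of_ne_zero hnc
  have hd : (0 : ℝ) < γ.natDegree := by
    have := natDegree_sub_le γ c
    exact_mod_cast (show 0 < γ.natDegree by omega)
  have hlog : Real.logb 2 (110 * (γ.natDegree : ℝ) / ((γ - c).natDegree : ℝ)) < i := by
    push_cast at hlt
    linarith
  rw [Real.logb_lt_iff_lt_rpow one_lt_two (by positivity), Real.rpow_natCast, div_lt_iff₀ he]
    at hlog
  rw [← hdeg]
  exact_mod_cast (show (γ.natDegree : ℝ) < 2 ^ i * (γ - c).natDegree by linarith)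
end

section
/- Let k be a field of characteristic zero, K = k(t), let d ≥ 1 be an integer, let m ∈ k, and let φ(x) = (x − t^d)² + (t^d + m) ∈ k[t][x]. If the critical orbit {φ^n(t^d) : n ≥ 1} is infinite, then for every n ≥ 1 the splitting field K_n of φ^n over K satisfies [K_n : K] = 2^(2^n − 1); that is, the arboreal Galois representation is surjective: G_∞(φ) ≅ Aut(T_∞(φ)). -/
open Polynomial

namespace QuadIterate

section Ring

variable {S T : Type*} [CommRing S] [CommRing T]

/-- The monic quadratic `(X - a)² + e`, with critical point `a` and critical value `e`. -/
noncomputable def quad (a e : S) : S[X] := (X - C a) ^ 2 + C e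

/-- The `n`-th iterate of `quad a e`. -/
noncomputable def iter (a e : S) (n : ℕ) : S[X] := (fun p => p.comp (quad a e))^[n] X

lemma iter_zero (a e : S) : iter a e 0 = X := rfl

lemma iter_succ (a e : S) (n : ℕ) : iter a e (n + 1) = (iter a e n).comp (quad a e) :=
  Function.iterate_succ_apply' _ _ _

lemma map_quad (f : S →+* T) (a e : S) : (quad a e).map f = quad (f a) (f e) := by
  simp [quad]

lemma map_iter (f : S →+* T) (a e : S) (n : ℕ) :
    (iter a e n).map f = iter (f a) (f e) n := by
  induction n with
  | zero => simp [iter_zero]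
  | succ n ih => rw [iter_succ, iter_succ, Polynomial.map_comp, ih, map_quad]

lemma eval_iter_succ (a e x : S) (n : ℕ) :
    (iter a e (n + 1)).eval x = (iter a e n).eval ((x - a) ^ 2 + e) := by
  simp [iter_succ, eval_comp, quad]

lemma eval_critical (a e : S) (n : ℕ) :
    (iter a e (n + 1)).eval a = (iter a e n).eval e := by
  simp [eval_iter_succ]

lemma natDegree_quad [Nontrivial S] (a e : S) : (quad a e).natDegree = 2 := by
  unfold quad; compute_degree!

lemma monic_quad (a e : S) : (quad a e).Monic := by
  unfold quad; monicity!

lemma monic_iter [IsDomain S] (a e : S) (n : ℕ) : (iter a e n).Monic := by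
  induction n with
  | zero => exact monic_X
  | succ n ih =>
    rw [iter_succ]
    exact ih.comp (monic_quad a e) (by simp [natDegree_quad])

lemma natDegree_iter [IsDomain S] (a e : S) (n : ℕ) : (iter a e n).natDegree = 2 ^ n := by
  induction n with
  | zero => simp [iter_zero]
  | succ n ih => rw [iter_succ, natDegree_comp, ih, natDegree_quad, pow_succ]

end Ring

section Place

variable {R : Type*} [CommRing R] [IsDomain R] {a e π : R}

/-- If every element not divisible by `π` is a square and `π` does not divide the first `n` points
of the critical orbit, then the `n`-th iterate splits. -/
lemma splits_iter (hsq : ∀ r : R, ¬ π ∣ r → IsSquare r) (n : ℕ)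
    (h : ∀ j < n, ¬ π ∣ (iter a e (j + 1)).eval a) : (iter a e n).Splits := by
  induction n with
  | zero => simp [iter_zero]
  | succ n ih =>
    have hs := ih fun j hj => h j (by omega)
    have hn := h n (by omega)
    rw [eval_critical, hs.eval_eq_prod_roots_of_monic (monic_iter a e n)] at hn
    rw [iter_succ, hs.eq_prod_roots_of_monic (monic_iter a e n), multiset_prod_comp,
      Multiset.map_map]
    refine Splits.multisetProd fun f hf => ?_
    obtain ⟨b, hb, rfl⟩ := Multiset.mem_map.1 hf
    have hb' : ¬ π ∣ b - e := fun hd => hn <| by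
      rw [← dvd_neg, neg_sub] at hd
      exact hd.trans (Multiset.dvd_prod (Multiset.mem_map_of_mem (fun r => e - r) hb))
    obtain ⟨r, hr⟩ := hsq _ hb'
    have : (X - C b).comp (quad a e) = (X - C (a + r)) * (X - C (a - r)) := by
      have h2 : (C b : R[X]) - C e = C r * C r := by rw [← C_sub, hr, C_mul]
      simp only [quad, sub_comp, X_comp, C_comp, C_add, C_sub]
      linear_combination -h2
    simp only [Function.comp_apply, this]
    exact (Splits.X_sub_C _).mul (Splits.X_sub_C _)

/-- If the prime `π` divides exactly once the next point of the critical orbit, then exactly one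
root of the `n`-th iterate is congruent to the critical value modulo `π`. -/
lemma exists_special_root (hπ : Prime π) (n : ℕ) (hs : (iter a e n).Splits)
    (h1 : π ∣ (iter a e (n + 1)).eval a) (h2 : ¬ π ^ 2 ∣ (iter a e (n + 1)).eval a) :
    ∃ (b : R) (q : R[X]), iter a e n = (X - C b) * q ∧ π ∣ b - e ∧ ¬ π ^ 2 ∣ b - e ∧
      ¬ π ∣ q.eval e := by
  rw [eval_critical] at h1 h2
  have h3 := h1
  rw [hs.eval_eq_prod_roots_of_monic (monic_iter a e n)] at h3
  obtain ⟨b, hb, hd⟩ := hπ.exists_mem_multiset_map_dvd h3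
  obtain ⟨q, hq⟩ := dvd_iff_isRoot.2 (isRoot_of_mem_roots hb)
  have he : (iter a e n).eval e = (e - b) * q.eval e := by simp [hq]
  rw [he] at h2
  refine ⟨b, q, hq, by rwa [← dvd_neg, neg_sub], fun hd => h2 ?_, fun hd' => h2 ?_⟩
  · rw [← dvd_neg, neg_sub] at hd
    exact hd.mul_right _
  · rw [sq]; exact mul_dvd_mul hd hd'

lemma not_isSquare_algebraMap {R : Type*} [CommRing R] [IsIntegrallyClosed R] {π : R}
    (E : Type*) [Field E] [Algebra R E] [IsFractionRing R E] (hπ : Prime π) {r : R}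
    (h1 : π ∣ r) (h2 : ¬ π ^ 2 ∣ r) (x : E) :
    x ^ 2 ≠ algebraMap R E r := by
  intro hx
  obtain ⟨y, rfl⟩ := IsIntegrallyClosed.exists_algebraMap_eq_of_isIntegral_pow (R := R) (n := 2)
    two_pos (by rw [hx]; exact isIntegral_algebraMap)
  rw [← map_pow] at hx
  have := IsFractionRing.injective R E hx
  subst this
  exact h2 (pow_dvd_pow_of_dvd (hπ.dvd_of_dvd_pow h1) 2)

end Place

section Tower

open IntermediateField

/-- Adjoining square roots, none of which lies in the field generated by the others. -/
lemma finrank_adjoin_sqrt {L Ω : Type*} [Field L] [Field Ω] [Algebra L Ω] {ι : Type*}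
    (y : ι → Ω) (hy : ∀ i, ∃ b : L, y i ^ 2 = algebraMap L Ω b)
    (hi : ∀ i, y i ∉ adjoin L (y '' {i}ᶜ)) (s : Finset ι) :
    Module.finrank L (adjoin L (y '' s)) = 2 ^ s.card := by
  classical
  induction s using Finset.induction_on with
  | empty => simp
  | insert i s his ih =>
    rw [Finset.card_insert_of_notMem his, Finset.coe_insert, Set.image_insert_eq,
      ← Set.union_singleton, ← adjoin_adjoin_left]
    obtain ⟨b, hb⟩ := hy i
    have hnot : y i ∉ adjoin L (y '' s) := fun h => hi i <| by
      refine adjoin.mono L _ _ (Set.image_mono ?_) h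
      rintro j hj rfl
      exact his hj
    set M := adjoin L (y '' (s : Set ι))
    have hirr : Irreducible (X ^ 2 - C (algebraMap L M b) : M[X]) := by
      refine X_pow_sub_C_irreducible_of_prime Nat.prime_two fun c hc => hnot ?_
      have hc' : (c : Ω) ^ 2 = y i ^ 2 := by
        rw [hb, ← SubmonoidClass.coe_pow, hc]
        rfl
      rcases sq_eq_sq_iff_eq_or_eq_neg.1 hc' with h | h
      · rw [← h]; exact c.2
      · rw [← neg_eq_iff_eq_neg.2 h]; exact neg_mem c.2
    have hmin : minpoly M (y i) = X ^ 2 - C (algebraMap L M b) := by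
      refine (minpoly.eq_of_irreducible_of_monic hirr ?_ (monic_X_pow_sub_C _ two_ne_zero)).symm
      simp [hb, ← IsScalarTower.algebraMap_apply]
    have hint : IsIntegral M (y i) :=
      ⟨X ^ 2 - C (algebraMap L M b), monic_X_pow_sub_C _ two_ne_zero, by
        simp [hb, ← IsScalarTower.algebraMap_apply]⟩
    have h2 : Module.finrank M (adjoin M {y i}) = 2 := by
      rw [adjoin.finrank hint, hmin, natDegree_X_pow_sub_C]
    have := Module.finrank_mul_finrank L M (adjoin M {y i})
    rw [ih, h2] at this
    rw [pow_succ, this]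
    rfl

end Tower

section Separating

open IntermediateField

variable {K : Type*} [Field K]

/-- The `n`-th iterate of `quad a e` splits in the extension `E` of `K`, and exactly one of its
roots does not become a square when the critical value is subtracted. -/
structure IsSeparating (a e : K) (n : ℕ) (E : Type*) [Field E] [Algebra K E] : Prop where
  splits : ((iter a e n).map (algebraMap K E)).Splits
  exists_root : ∃ b : E, aeval b (iter a e n) = 0 ∧ (∀ x, x ^ 2 ≠ b - algebraMap K E e) ∧
    ∀ b', aeval b' (iter a e n) = 0 → b' ≠ b → ∃ x, x ^ 2 = b' - algebraMap K E e

lemma isSeparating_of_prime {a e : K} {n : ℕ} {R E : Type*} [CommRing R] [IsDomain R]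
    [IsIntegrallyClosed R] [Field E] [Algebra R E] [IsFractionRing R E] [Algebra K E]
    {α ε π : R} (hα : algebraMap K E a = algebraMap R E α)
    (hε : algebraMap K E e = algebraMap R E ε) (hπ : Prime π)
    (hsq : ∀ r : R, ¬ π ∣ r → IsSquare r)
    (h : ∀ j < n, ¬ π ∣ (iter α ε (j + 1)).eval α)
    (h1 : π ∣ (iter α ε (n + 1)).eval α) (h2 : ¬ π ^ 2 ∣ (iter α ε (n + 1)).eval α) :
    IsSeparating a e n E := by
  have hmap : (iter a e n).map (algebraMap K E) = (iter α ε n).map (algebraMap R E) := by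
    rw [map_iter, map_iter, hα, hε]
  have hs := splits_iter hsq n h
  obtain ⟨b, q, hbq, hb1, hb2, hq⟩ := exists_special_root hπ n hs h1 h2
  have haeval (x : E) : aeval x (iter a e n) = aeval x (iter α ε n) := by
    rw [← eval_map_algebraMap, hmap, eval_map_algebraMap]
  refine ⟨hmap ▸ hs.map _, algebraMap R E b, ?_, fun x hx => ?_, fun b' hb' hne => ?_⟩
  · rw [haeval, hbq]
    simp
  · rw [hε, ← map_sub] at hx
    exact not_isSquare_algebraMap E hπ hb1 hb2 x hx
  · rw [haeval] at hb'
    obtain ⟨c, rfl⟩ := IsIntegrallyClosed.isIntegral_iff.1 ⟨_, monic_iter α ε n, hb'⟩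
    have hc : (iter α ε n).eval c = 0 := by
      apply IsFractionRing.injective R E
      rw [map_zero, ← hb', aeval_algebraMap_apply_eq_algebraMap_eval]
    have hcb : c ≠ b := fun h => hne (h ▸ rfl)
    have hqc : q.eval c = 0 := by
      rw [hbq, eval_mul] at hc
      simpa [sub_eq_zero, hcb] using hc
    obtain ⟨r, hr⟩ := hsq (c - ε) fun hd => hq <| by
      have := q.sub_dvd_eval_sub ε c
      rw [hqc, sub_zero] at this
      rw [← dvd_neg, neg_sub] at hd
      exact hd.trans this
    exact ⟨algebraMap R E r, by rw [hε, ← map_sub, hr, ← map_pow, sq]⟩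

/-- If every earlier iterate admits a separating extension, the `n`-th iterate is irreducible. -/
lemma irreducible_iter {a e : K} (n : ℕ)
    (h : ∀ j < n, ∃ (E : Type*) (_ : Field E) (_ : Algebra K E), IsSeparating a e j E) :
    Irreducible (iter a e n) := by
  induction n with
  | zero => exact irreducible_X
  | succ n ih =>
    rw [iter_succ]
    refine irreducible_comp (monic_iter a e n) (monic_quad a e) (ih fun j hj => h j (by omega)) ?_
    intro M _ _ x hx
    obtain ⟨E, _, _, hE⟩ := h n (by omega)
    obtain ⟨b, hb, hbe, -⟩ := hE.exists_root
    have hint : IsIntegral K x := by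
      by_contra hcon
      exact (monic_iter a e n).ne_zero (hx ▸ minpoly.eq_zero hcon)
    let f : K⟮x⟯ →ₐ[K] E := (algHomAdjoinIntegralEquiv K hint).symm
      ⟨b, mem_aroots.2 ⟨minpoly.ne_zero hint, hx ▸ hb⟩⟩
    have hf : f (AdjoinSimple.gen K x) = b := algHomAdjoinIntegralEquiv_symm_apply_gen K hint _
    have hdeg : ((quad a e).map (algebraMap K K⟮x⟯) - C (AdjoinSimple.gen K x)).natDegree = 2 := by
      rw [natDegree_sub_C, natDegree_map, natDegree_quad]
    refine irreducible_of_degree_le_three_of_not_isRoot (by simp [hdeg]) fun z hz => ?_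
    have hz' : (z - algebraMap K K⟮x⟯ a) ^ 2 =
        AdjoinSimple.gen K x - algebraMap K K⟮x⟯ e := by
      rw [IsRoot.def, map_quad] at hz
      simp only [quad, eval_sub, eval_add, eval_pow, eval_X, eval_C] at hz
      linear_combination hz
    apply hbe (f z - algebraMap K E a)
    simpa [hf] using congrArg f hz'

lemma finrank_adjoin_rootSet_succ [CharZero K] {Ω : Type*} [Field Ω] [Algebra K Ω] [IsAlgClosed Ω]
    {a e : K} {n : ℕ} (hirr : Irreducible (iter a e n)) {E : Type*} [Field E] [Algebra K E]
    (hE : IsSeparating a e n E) :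
    Module.finrank K (adjoin K ((iter a e (n + 1)).rootSet Ω)) =
      Module.finrank K (adjoin K ((iter a e n).rootSet Ω)) * 2 ^ 2 ^ n := by
  set B := (iter a e n).rootSet Ω
  have hmemB (x : Ω) : x ∈ B ↔ aeval x (iter a e n) = 0 :=
    mem_rootSet_of_ne (monic_iter a e n).ne_zero
  have hsqrt (β : B) : ∃ y : Ω, y ^ 2 = β - algebraMap K Ω e :=
    IsAlgClosed.exists_pow_nat_eq _ two_pos
  choose y hy using hsqrt
  have hmin (β : B) : minpoly K (β : Ω) = iter a e n :=
    (minpoly.eq_of_irreducible_of_monic hirr ((hmemB β).1 β.2) (monic_iter a e n)).symm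
  have hint (β : B) : IsIntegral K (β : Ω) := ⟨_, monic_iter a e n, (hmemB β).1 β.2⟩
  set L := adjoin K B with hL
  have hBL (β : B) : (β : Ω) ∈ L := subset_adjoin K B β.2
  let r (β : B) : L := ⟨β, hBL β⟩ - algebraMap K L e
  have hr (β : B) : y β ^ 2 = algebraMap L Ω (r β) := hy β
  have hnot (i : B) : y i ∉ adjoin L (y '' {i}ᶜ) := by
    obtain ⟨b, hb, hbe, hbs⟩ := hE.exists_root
    obtain ⟨f, hf⟩ := exists_algHom_adjoin_of_splits_of_aeval (F := K) (S := B) (K := E)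
      (fun s hs => ⟨hint ⟨s, hs⟩, by rw [hmin ⟨s, hs⟩]; exact hE.splits⟩) (hBL i)
      (y := b) (by rw [hmin i]; exact hb)
    have hfr (j : B) : f (r j) = f ⟨j, hBL j⟩ - algebraMap K E e :=
      (map_sub f _ _).trans (congrArg _ (f.commutes e))
    obtain ⟨g, hg⟩ := exists_algHom_adjoin_of_splits' (S := y '' {i}ᶜ) f (by
      rintro _ ⟨j, hj, rfl⟩
      have hroot : aeval (y j) (X ^ 2 - C (r j) : L[X]) = 0 := by simp [hr]
      refine ⟨⟨_, monic_X_pow_sub_C (r j) two_ne_zero, hroot⟩, ?_⟩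
      have hdvd := Polynomial.map_dvd f.toRingHom (minpoly.dvd L _ hroot)
      refine Splits.of_dvd ?_ ?_ hdvd
      · obtain ⟨x, hx⟩ := hbs (f ⟨j, hBL j⟩)
          (by
            rw [aeval_algHom_apply]
            have : aeval (⟨j, hBL j⟩ : L) (iter a e n) = 0 :=
              (algebraMap L Ω).injective (by
                rw [← aeval_algebraMap_apply, map_zero]
                exact (hmemB j).1 j.2)
            rw [this, map_zero])
          (fun h => hj <| by
            have := f.injective (h.trans hf.symm)
            exact Subtype.ext (congrArg (Subtype.val : L → Ω) this))
        have : (X ^ 2 - C (r j) : L[X]).map f.toRingHom = (X - C x) * (X + C x) := by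
          have h2 : f.toRingHom (r j) = x ^ 2 := (hfr j).trans hx.symm
          simp only [Polynomial.map_sub, Polynomial.map_pow, map_X, map_C, h2, C_pow]
          ring
        rw [this]
        exact (Splits.X_sub_C _).mul (Splits.X_add_C _)
      · exact ((monic_X_pow_sub_C (r j) two_ne_zero).map _).ne_zero)
    intro hmem
    have hsq : (⟨y i, hmem⟩ : adjoin L (y '' {i}ᶜ)) ^ 2 = algebraMap L _ (r i) :=
      Subtype.ext (hr i)
    have hgr : g (algebraMap L _ (r i)) = f (r i) := DFunLike.congr_fun hg (r i)
    apply hbe (g ⟨y i, hmem⟩)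
    rw [← map_pow, hsq, hgr, hfr, hf]
  have hcard : Fintype.card B = 2 ^ n := by
    rw [card_rootSet_eq_natDegree hirr.separable (IsAlgClosed.splits _), natDegree_iter]
  have hfin := finrank_adjoin_sqrt y (fun i => ⟨r i, hr i⟩) hnot Finset.univ
  rw [Finset.card_univ, hcard, Finset.coe_univ, Set.image_univ] at hfin
  have hadj : adjoin K ((iter a e (n + 1)).rootSet Ω) =
      (adjoin L (Set.range y)).restrictScalars K := by
    rw [hL, adjoin_adjoin_left]
    have hmem (x : Ω) : x ∈ (iter a e (n + 1)).rootSet Ω ↔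
        (x - algebraMap K Ω a) ^ 2 + algebraMap K Ω e ∈ B := by
      rw [mem_rootSet_of_ne (monic_iter a e (n + 1)).ne_zero, hmemB, ← eval_map_algebraMap,
        map_iter, eval_iter_succ, ← map_iter, eval_map_algebraMap]
    have hmem' (β : B) : y β + algebraMap K Ω a ∈ (iter a e (n + 1)).rootSet Ω := by
      rw [hmem, add_sub_cancel_right, hy, sub_add_cancel]
      exact β.2
    apply le_antisymm <;> rw [adjoin_le_iff]
    · intro x hx
      rw [hmem] at hx
      have hyx := hy ⟨_, hx⟩
      rw [add_sub_cancel_right] at hyx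
      have hyM : y ⟨_, hx⟩ ∈ adjoin K (B ∪ Set.range y) :=
        subset_adjoin _ _ (.inr ⟨_, rfl⟩)
      have haM := (adjoin K (B ∪ Set.range y)).algebraMap_mem a
      rcases sq_eq_sq_iff_eq_or_eq_neg.1 hyx with h | h
      · have := add_mem hyM haM
        rwa [h, sub_add_cancel] at this
      · have := sub_mem haM hyM
        rwa [h, sub_neg_eq_add, add_sub_cancel] at this
    · have hyN (β : B) : y β ∈ adjoin K ((iter a e (n + 1)).rootSet Ω) := by
        have := sub_mem (subset_adjoin K _ (hmem' β))
          ((adjoin K ((iter a e (n + 1)).rootSet Ω)).algebraMap_mem a)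
        rwa [add_sub_cancel_right] at this
      rintro x (hx | ⟨β, rfl⟩)
      · have := add_mem (pow_mem (hyN ⟨x, hx⟩) 2)
          ((adjoin K ((iter a e (n + 1)).rootSet Ω)).algebraMap_mem e)
        rwa [hy, sub_add_cancel] at this
      · exact hyN β
  rw [hadj, ← hfin]
  exact (Module.finrank_mul_finrank K L (adjoin L (Set.range y))).symm

theorem finrank_splittingField_iter [CharZero K] {a e : K}
    (h : ∀ j, ∃ (E : Type*) (_ : Field E) (_ : Algebra K E), IsSeparating a e j E) (n : ℕ) :
    Module.finrank K (iter a e n).SplittingField = 2 ^ (2 ^ n - 1) := by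
  have key : Module.finrank K (adjoin K ((iter a e n).rootSet (AlgebraicClosure K))) =
      2 ^ (2 ^ n - 1) := by
    induction n with
    | zero =>
      have : (iter a e 0).rootSet (AlgebraicClosure K) = {0} := by
        ext x
        simp [iter_zero, mem_rootSet]
      simp [this]
    | succ n ih =>
      obtain ⟨E, _, _, hE⟩ := h n
      rw [finrank_adjoin_rootSet_succ (irreducible_iter n fun j _ => h j) hE, ih, ← pow_add]
      congr 1
      have := Nat.one_le_two_pow (n := n)
      rw [pow_succ]
      omega
  have := adjoin_rootSet_isSplittingField
    (IsAlgClosed.splits ((iter a e n).map (algebraMap K (AlgebraicClosure K))))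
  rw [← key]
  exact (IsSplittingField.algEquiv (adjoin K ((iter a e n).rootSet (AlgebraicClosure K)))
    (iter a e n)).toLinearEquiv.finrank_eq.symm

end Separating

universe u

section RationalFunctions

lemma iterate_eq_eval_iter {S : Type*} [CommRing S] (a e x : S) (n : ℕ) :
    (fun z => (z - a) ^ 2 + e)^[n] x = (iter a e n).eval x := by
  induction n generalizing x with
  | zero => simp [iter_zero]
  | succ n ih => rw [Function.iterate_succ_apply, ih, eval_iter_succ]

lemma eval_iter_add {S : Type*} [CommRing S] (c m x : S) (n : ℕ) :
    (iter c (c + m) n).eval (x + c) = (iter 0 m n).eval x + c := by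
  induction n generalizing x with
  | zero => simp [iter_zero]
  | succ n ih =>
    rw [eval_iter_succ, eval_iter_succ, ← ih]
    congr 1
    ring

lemma eval_iter_self_add_C {S : Type*} [CommRing S] (c : S[X]) (m : S) (n : ℕ) :
    (iter c (c + C m) n).eval c = c + C ((iter 0 m n).eval 0) := by
  have h := eval_iter_add c (C m) 0 n
  have hC : (iter 0 m n).map C = iter 0 (C m) n := by simpa using map_iter C 0 m n
  rw [zero_add, ← hC, ← C_0, eval_map_apply] at h
  rw [h, add_comm]

lemma iterate_injective_of_infinite {S : Type*} (F : S → S) (x : S)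
    (h : Set.Infinite {y | ∃ n : ℕ, 1 ≤ n ∧ F^[n] x = y}) :
    Function.Injective fun n => F^[n] x := by
  by_contra hinj
  obtain ⟨i, j, hij, heq⟩ : ∃ i j, i < j ∧ F^[i] x = F^[j] x := by
    simp only [Function.Injective, not_forall] at hinj
    obtain ⟨i, j, heq, hne⟩ := hinj
    rcases lt_or_gt_of_ne hne with h | h
    exacts [⟨i, j, h, heq⟩, ⟨j, i, h, heq.symm⟩]
  apply h
  refine ((Set.finite_lt_nat j).image fun n => F^[n] x).subset ?_
  rintro _ ⟨n, -, rfl⟩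
  induction n using Nat.strong_induction_on with
  | _ n ih =>
    by_cases hn : n < j
    · exact ⟨n, hn, rfl⟩
    · have h1 : F^[n] x = F^[n - j + i] x := by
        rw [Function.iterate_add_apply, heq,
          ← Function.iterate_add_apply]
        congr 2
        omega
      rw [h1]
      exact ih _ (by omega)

lemma isSquare_of_not_X_dvd {F : Type*} [Field F] [CharZero F] [IsAlgClosed F]
    (r : PowerSeries F) (hr : ¬ PowerSeries.X ∣ r) : IsSquare r := by
  rw [PowerSeries.X_dvd_iff] at hr
  obtain ⟨s, hs⟩ := IsAlgClosed.exists_pow_nat_eq (PowerSeries.constantCoeff r) two_pos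
  have hs0 : s ≠ 0 := by
    rintro rfl
    exact hr (by simp [← hs])
  obtain ⟨y, hy, -⟩ := HenselianRing.is_henselian
    (I := Ideal.span {(PowerSeries.X : PowerSeries F)})
    (X ^ 2 - C r) (monic_X_pow_sub_C r two_ne_zero) (PowerSeries.C s)
    (by
      rw [Ideal.mem_span_singleton, PowerSeries.X_dvd_iff]
      simp [hs])
    (by
      apply IsUnit.map
      rw [PowerSeries.isUnit_iff_constantCoeff]
      simp [hs0])
  refine ⟨y, ?_⟩
  simpa [sub_eq_zero, sq, eq_comm] using hy

variable {k : Type u} [Field k]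

/-- Expansion of a polynomial around a point `s` of the algebraic closure. -/
noncomputable def expand (s : AlgebraicClosure k) : k[X] →+* PowerSeries (AlgebraicClosure k) :=
  coeToPowerSeries.ringHom.comp
    ((taylorAlgHom s).toRingHom.comp (mapRingHom (algebraMap k (AlgebraicClosure k))))

lemma coeff_expand (s : AlgebraicClosure k) (p : k[X]) (n : ℕ) :
    PowerSeries.coeff n (expand s p) =
      (taylor s (p.map (algebraMap k (AlgebraicClosure k)))).coeff n := by
  simp [expand]

lemma expand_injective (s : AlgebraicClosure k) : Function.Injective (expand s) := by
  refine Polynomial.coe_injective _ |>.comp ((taylor_injective s).comp ?_)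
  exact map_injective _ (algebraMap k (AlgebraicClosure k)).injective

lemma exists_isSeparating [CharZero k] {d : ℕ} (hd : 1 ≤ d) {m : k}
    (horb : Function.Injective fun n => (iter 0 m n).eval 0) (n : ℕ) :
    ∃ (E : Type u) (_ : Field E) (_ : Algebra (RatFunc k) E),
      IsSeparating (algebraMap k[X] (RatFunc k) (X ^ d))
        (algebraMap k[X] (RatFunc k) (X ^ d + C m)) n E := by
  set A : ℕ → k := fun n => (iter 0 m n).eval 0 with hA
  have hA0 : A 0 = 0 := by simp [hA, iter_zero]
  obtain ⟨s, hs⟩ := IsAlgClosed.exists_pow_nat_eq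
    (algebraMap k (AlgebraicClosure k) (-A (n + 1))) hd
  have hs0 : s ≠ 0 := by
    rintro rfl
    rw [zero_pow (by omega), eq_comm, map_eq_zero, neg_eq_zero, ← hA0] at hs
    exact absurd (horb hs) (by omega)
  have hcrit (j : ℕ) : (iter (expand s (X ^ d)) (expand s (X ^ d + C m)) j).eval
      (expand s (X ^ d)) = expand s (X ^ d + C (A j)) := by
    rw [← map_iter, eval_map_apply, eval_iter_self_add_C]
  have hdvd (j : ℕ) : PowerSeries.X ∣ expand s (X ^ d + C (A j)) ↔ j = n + 1 := by
    rw [PowerSeries.X_dvd_iff, ← PowerSeries.coeff_zero_eq_constantCoeff_apply, coeff_expand,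
      taylor_coeff_zero]
    simp only [Polynomial.map_add, Polynomial.map_pow, map_X, map_C, eval_add, eval_pow, eval_X,
      eval_C, hs]
    rw [← map_add, map_eq_zero, neg_add_eq_zero]
    exact ⟨fun h => (horb h).symm, fun h => h ▸ rfl⟩
  have hdvd2 : ¬ PowerSeries.X ^ 2 ∣ expand s (X ^ d + C (A (n + 1))) := by
    intro h
    have h1 := PowerSeries.X_pow_dvd_iff.1 h 1 one_lt_two
    rw [coeff_expand, taylor_coeff_one] at h1
    have : (d : AlgebraicClosure k) ≠ 0 := Nat.cast_ne_zero.2 (by omega)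
    simp [derivative_X_pow, hs0, this] at h1
  let E := FractionRing (PowerSeries (AlgebraicClosure k))
  let σ : k[X] →+* E := (algebraMap _ E).comp (expand s)
  have hσ : Function.Injective σ :=
    (IsFractionRing.injective (PowerSeries (AlgebraicClosure k)) E).comp (expand_injective s)
  let τ : RatFunc k →+* E := IsFractionRing.lift hσ
  let _ : Algebra (RatFunc k) E := τ.toAlgebra
  have hτ (p : k[X]) : algebraMap (RatFunc k) E (algebraMap k[X] (RatFunc k) p) =
      algebraMap _ E (expand s p) := IsFractionRing.lift_algebraMap hσ p
  refine ⟨E, inferInstance, inferInstance,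
    isSeparating_of_prime (hτ _) (hτ _) PowerSeries.X_prime isSquare_of_not_X_dvd ?_ ?_ ?_⟩
  · intro j hj
    rw [hcrit, hdvd]
    omega
  · rw [hcrit, hdvd]
  · rwa [hcrit]

end RationalFunctions

end QuadIterate

/-- Proposition 2: for `φ(x) = (x - t^d)² + (t^d + m)` with `d ≥ 1` and `m ∈ k`, if the
critical orbit `{φ^n(t^d) : n ≥ 1}` is infinite, then the arboreal representation is
surjective: `[K_n : K] = 2^(2^n - 1)` for all `n ≥ 1`. -/
theorem surjective_arboreal_isotrivial_family (k : Type*) [Field k] [CharZero k]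
    (d : ℕ) (hd : 1 ≤ d) (m : k)
    (φ : Polynomial (RatFunc k))
    (hφ : φ = (X - Polynomial.C (algebraMap (Polynomial k) (RatFunc k)
                  ((Polynomial.X : Polynomial k) ^ d))) ^ 2
            + Polynomial.C (algebraMap (Polynomial k) (RatFunc k)
                  ((Polynomial.X : Polynomial k) ^ d + Polynomial.C m)))
    (horb : Set.Infinite
      {x : Polynomial k | ∃ n : ℕ, 1 ≤ n ∧
        (fun a => (a - (Polynomial.X : Polynomial k) ^ d) ^ 2
            + ((Polynomial.X : Polynomial k) ^ d + Polynomial.C m))^[n]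
          ((Polynomial.X : Polynomial k) ^ d) = x}) :
    ∀ n : ℕ, 1 ≤ n →
      Module.finrank (RatFunc k)
        (Polynomial.SplittingField ((fun p => p.comp φ)^[n] (X : Polynomial (RatFunc k))))
      = 2 ^ (2 ^ n - 1) := by
  intro n _
  have horb' : Function.Injective fun n => (QuadIterate.iter 0 m n).eval 0 := by
    intro i j hij
    apply QuadIterate.iterate_injective_of_infinite _ _ horb
    simp only [QuadIterate.iterate_eq_eval_iter, QuadIterate.eval_iter_self_add_C]
    exact congrArg (fun z => X ^ d + C z) hij
  rw [hφ]
  exact QuadIterate.finrank_splittingField_iter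
    (QuadIterate.exists_isSeparating hd horb') n
end

section
/- Let m ∈ ℚ and let f(x) = x² + m. If the forward orbit of 0 under f, i.e. the set {f^n(0) : n ≥ 1}, is finite (f is post-critically finite), then m ∈ {0, −1, −2}. -/
/-- A function that strictly increases along the map `x ↦ x² + m` above the level of `m`
rules out a finite critical orbit. -/
lemma critical_orbit_infinite_of_lt {m : ℚ} (N : ℚ → ℚ)
    (hN : ∀ x, N m ≤ N x → N x < N (x ^ 2 + m)) :
    {x : ℚ | ∃ n : ℕ, 1 ≤ n ∧ (fun z => z ^ 2 + m)^[n] 0 = x}.Infinite := by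
  intro hfin
  have hlevel : ∀ n : ℕ, N m ≤ N ((fun z => z ^ 2 + m)^[n + 1] 0) := by
    intro n
    induction n with
    | zero => simp
    | succ n ih =>
      rw [Function.iterate_succ_apply']
      exact ih.trans (hN _ ih).le
  obtain ⟨_, ⟨n, hn, rfl⟩, hmax⟩ := Set.exists_max_image _ N hfin ⟨_, 1, le_rfl, rfl⟩
  obtain ⟨k, rfl⟩ := Nat.exists_eq_add_of_le' hn
  have hle := hmax _ ⟨k + 1 + 1, by omega, rfl⟩
  rw [Function.iterate_succ_apply' _ (k + 1)] at hle
  exact hle.not_gt (hN _ (hlevel k))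

lemma padicNorm_lt_padicNorm_sq_add {p : ℕ} [Fact p.Prime] {m x : ℚ}
    (hm : 1 < padicNorm p m) (hx : padicNorm p m ≤ padicNorm p x) :
    padicNorm p x < padicNorm p (x ^ 2 + m) := by
  have hsq : padicNorm p (x ^ 2) = padicNorm p x * padicNorm p x := by
    rw [sq, padicNorm.mul]
  have hlt : padicNorm p x < padicNorm p (x ^ 2) := by nlinarith
  rw [padicNorm.add_eq_max_of_ne (hx.trans_lt hlt).ne']
  exact hlt.trans_le (le_max_left _ _)

lemma Rat.exists_one_lt_padicNorm {m : ℚ} (hm : m.den ≠ 1) :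
    ∃ p : ℕ, p.Prime ∧ 1 < padicNorm p m := by
  obtain ⟨p, hp, hpd⟩ := Nat.exists_prime_and_dvd hm
  have := Fact.mk hp
  refine ⟨p, hp, ?_⟩
  have hnum : padicNorm p (m.num : ℚ) = 1 := by
    rw [padicNorm.int_eq_one_iff]
    intro h
    exact hp.one_lt.ne' (Nat.eq_one_of_dvd_coprimes m.reduced (Int.natCast_dvd.mp h) hpd)
  have hden : padicNorm p (m.den : ℚ) < 1 := (padicNorm.nat_lt_one_iff _).mpr hpd
  have hmul : padicNorm p m * padicNorm p (m.den : ℚ) = 1 := by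
    rw [← padicNorm.mul, Rat.mul_den_eq_num, hnum]
  by_contra! hle
  nlinarith [padicNorm.nonneg (p := p) m, padicNorm.nonneg (p := p) (m.den : ℚ)]

lemma abs_lt_abs_sq_add_of_one_le {m : ℚ} (hm : 1 ≤ m) (x : ℚ) : |x| < |x ^ 2 + m| := by
  refine lt_of_lt_of_le ?_ (le_abs_self _)
  nlinarith [sq_abs x, sq_nonneg (|x| - 1), abs_nonneg x]

lemma abs_lt_abs_sq_add_of_lt_neg_two {m x : ℚ} (hm : m < -2) (hx : |m| ≤ |x|) :
    |x| < |x ^ 2 + m| := by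
  refine lt_of_lt_of_le ?_ (le_abs_self _)
  rw [abs_of_neg (by linarith)] at hx
  nlinarith [sq_abs x]

/-- Post-critically finite parameters over ℚ: if the orbit `{f^n(0) : n ≥ 1}` of the
critical point of `f(x) = x² + m` is finite, then `m ∈ {0, -1, -2}`. -/
theorem pcf_rational_params (m : ℚ)
    (hfin : Set.Finite {x : ℚ | ∃ n : ℕ, 1 ≤ n ∧ (fun z => z ^ 2 + m)^[n] 0 = x}) :
    m = 0 ∨ m = -1 ∨ m = -2 := by
  have hden : m.den = 1 := by
    by_contra h
    obtain ⟨p, hp, hpm⟩ := Rat.exists_one_lt_padicNorm h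
    have := Fact.mk hp
    exact critical_orbit_infinite_of_lt (padicNorm p)
      (fun _ => padicNorm_lt_padicNorm_sq_add hpm) hfin
  have hlt : m < 1 := by
    by_contra! h
    exact critical_orbit_infinite_of_lt abs
      (fun x _ => abs_lt_abs_sq_add_of_one_le h x) hfin
  have hge : -2 ≤ m := by
    by_contra! h
    exact critical_orbit_infinite_of_lt abs
      (fun _ => abs_lt_abs_sq_add_of_lt_neg_two h) hfin
  obtain ⟨k, rfl⟩ : ∃ k : ℤ, (k : ℚ) = m := ⟨m.num, Rat.coe_int_num_of_den_eq_one hden⟩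
  norm_cast at hlt hge ⊢
  omega
end

section
/- Let k be a field of characteristic zero, K = k(t), and let γ, c ∈ k[t] with φ(x) = (x−γ)² + c. Assume φ is stable, post-critically infinite, and h(φ) > 0. Let f ∈ k(t) be any non-constant rational function and set φ_f(x) = (x − γ(f))² + c(f) ∈ K[x]. Then there exists a constant C ≥ 1 such that for every n ≥ 1, 2^(2^n − 1) ≤ C · [L_n : K], where L_n is the splitting field of φ_f^n over K; in particular, the number of irreducible factors of φ_f^n over K is bounded independently of n. -/
open Polynomial

section Core
variable {F : Type*} [Field F] [CharZero F]

theorem derivative_mul_ne_two_mul_derivative {A c : F[X]} (hc : c ≠ 0)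
    (hA : c.natDegree < A.natDegree) :
    derivative c * A ≠ 2 * c * derivative A := by
  intro h
  have hA0 : A.natDegree ≠ 0 := by omega
  have hAne : A ≠ 0 := by rintro rfl; simp at hA0
  have h1 := congrArg (fun p => coeff p (c.natDegree + A.natDegree - 1)) h
  have e2 : coeff (2 * c * derivative A) (c.natDegree + A.natDegree - 1)
      = 2 * (c.leadingCoeff * (A.leadingCoeff * A.natDegree)) := by
    rw [show c.natDegree + A.natDegree - 1 = c.natDegree + (A.natDegree - 1) by omega, mul_assoc,
      ← C_ofNat, coeff_C_mul, coeff_mul_add_eq_of_natDegree_le le_rfl (natDegree_derivative_le A),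
      coeff_derivative, show A.natDegree - 1 + 1 = A.natDegree by omega]
    push_cast [Nat.one_le_iff_ne_zero.mpr hA0]
    simp
  have e1 : coeff (derivative c * A) (c.natDegree + A.natDegree - 1)
      = c.leadingCoeff * c.natDegree * A.leadingCoeff := by
    rcases Nat.eq_zero_or_pos c.natDegree with h0 | h0
    · rw [derivative_of_natDegree_zero h0]; simp [h0]
    · rw [show c.natDegree + A.natDegree - 1 = (c.natDegree - 1) + A.natDegree by omega,
        coeff_mul_add_eq_of_natDegree_le (natDegree_derivative_le c) le_rfl,
        coeff_derivative, show c.natDegree - 1 + 1 = c.natDegree by omega]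
      push_cast [Nat.one_le_iff_ne_zero.mpr h0.ne']
      simp
  simp only [e1, e2] at h1
  have hl := mul_ne_zero (leadingCoeff_ne_zero.mpr hc) (leadingCoeff_ne_zero.mpr hAne)
  have : (c.leadingCoeff * A.leadingCoeff) * ((c.natDegree : F) - 2 * A.natDegree) = 0 := by
    linear_combination h1
  have h3 := (mul_eq_zero.mp this).resolve_left hl
  have h4 : (c.natDegree : F) = ((2 * A.natDegree : ℕ) : F) := by
    push_cast; linear_combination h3
  have := Nat.cast_injective h4
  omega

theorem natDegree_le_of_quartic_eq_mul_sq {B c d e y : F[X]} {h : ℕ}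
    (hc : c ≠ 0) (hec : e ^ 2 + c ≠ 0) (hch : c.natDegree ≤ h) (heh : e.natDegree ≤ h)
    (heq : (B ^ 2 + e) ^ 2 + c = d * y ^ 2) :
    B.natDegree ≤ 2 * d.natDegree + 7 * h := by
  by_contra! hB
  have hB0 : B ≠ 0 := by rintro rfl; simp at hB
  set A := B ^ 2 + e with hAdef
  set b := B.natDegree with hb
  have hAdeg : A.natDegree = 2 * b := by
    rw [hAdef, natDegree_add_eq_left_of_natDegree_lt] <;> rw [natDegree_pow]
    omega
  have hdy : (d * y ^ 2).natDegree = 4 * b := by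
    rw [← heq, natDegree_add_eq_left_of_natDegree_lt] <;> rw [natDegree_pow, hAdeg] <;> omega
  have hdy0 : d * y ^ 2 ≠ 0 := by
    intro h0; rw [h0] at hdy; simp at hdy; omega
  have hd0 : d ≠ 0 := left_ne_zero_of_mul hdy0
  have hy0 : y ≠ 0 := fun h0 => hdy0 (by simp [h0])
  have hydeg : d.natDegree + 2 * y.natDegree = 4 * b := by
    rw [← hdy, natDegree_mul hd0 (pow_ne_zero 2 hy0), natDegree_pow]
  have hder := congrArg derivative heq
  simp only [derivative_add, derivative_mul, derivative_sq, map_ofNat] at hder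
  set q := 2 * derivative A * d * y - A * (derivative d * y + 2 * d * derivative y) with hq
  have hqy : q * y = 2 * c * derivative A - derivative c * A := by
    rw [hq]
    linear_combination (-2 * derivative A) * heq + A * hder
  have hq0 : q ≠ 0 := by
    intro h0
    rw [h0, zero_mul] at hqy
    exact derivative_mul_ne_two_mul_derivative hc (A := A) (by omega) (sub_eq_zero.mp hqy.symm).symm
  have hdc := natDegree_derivative_le c
  have hde := natDegree_derivative_le e
  have hdA := natDegree_derivative_le A
  have hdB := natDegree_derivative_le B
  have hqdeg : 2 * q.natDegree ≤ 2 * h + d.natDegree := by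
    have h1 : (q * y).natDegree ≤ h + 2 * b := by
      rw [hqy]
      compute_degree
      norm_num
      omega
    rw [natDegree_mul hq0 hy0] at h1
    omega
  set M := 4 * c * derivative B - derivative c * B with hM
  set r := 2 * c * derivative e - derivative c * e with hr
  have hMdeg : M.natDegree ≤ h + b := by
    rw [hM]; compute_degree; norm_num; omega
  have hrdeg : r.natDegree ≤ 2 * h := by
    rw [hr]; compute_degree; norm_num; omega
  have hqy' : q * y = B * M + r := by
    rw [hqy, hM, hr, hAdef]
    simp only [derivative_add, derivative_sq, map_ofNat]
    ring
  have hmain : d * (B * M + r) ^ 2 = q ^ 2 * ((B ^ 2 + e) ^ 2 + c) := by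
    rw [← hqy', heq]; ring
  have hrel : d * r ^ 2 - q ^ 2 * (e ^ 2 + c) = 0 := by
    refine eq_zero_of_dvd_of_natDegree_lt (p := B)
      ⟨q ^ 2 * (B ^ 3 + 2 * B * e) - d * (B * M ^ 2 + 2 * M * r), ?_⟩
      (lt_of_le_of_lt (b := d.natDegree + 4 * h) ?_ (by omega))
    · linear_combination hmain
    · compute_degree
      norm_num
      omega
  have hrel' : d * r ^ 2 = q ^ 2 * (e ^ 2 + c) := sub_eq_zero.mp hrel
  have hdr : d * r ^ 2 ≠ 0 := by
    rw [hrel']; exact mul_ne_zero (pow_ne_zero 2 hq0) hec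
  have hred : d * M * (B * M + 2 * r) = q ^ 2 * B * (B ^ 2 + 2 * e) := by
    apply mul_left_cancel₀ hB0
    linear_combination hmain - hrel'
  set s := q ^ 2 * (B ^ 2 + 2 * e) - d * M ^ 2 with hs
  have hsB : 2 * d * r * M = B * s := by
    rw [hs]; linear_combination hred
  have hsdeg : s.natDegree ≤ d.natDegree + 3 * h := by
    by_cases hs0 : s = 0
    · simp [hs0]
    have h1 : (B * s).natDegree ≤ d.natDegree + 2 * h + (h + b) := by
      rw [← hsB]; compute_degree; omega
    rw [natDegree_mul hB0 hs0] at h1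
    omega
  have hfin : B ^ 2 * (s ^ 2 - 4 * d * r ^ 2 * q ^ 2)
      = 8 * d * r ^ 2 * q ^ 2 * e - 4 * s * d * r ^ 2 := by
    apply mul_left_cancel₀ hB0
    linear_combination (4 * d * r ^ 2) * hred
      - (B * (2 * d * r * M + B * s) + 4 * d * r ^ 2) * hsB
  have hz : 8 * d * r ^ 2 * q ^ 2 * e - 4 * s * d * r ^ 2 = 0 := by
    refine eq_zero_of_dvd_of_natDegree_lt (p := B)
      ⟨B * (s ^ 2 - 4 * d * r ^ 2 * q ^ 2), ?_⟩
      (lt_of_le_of_lt (b := 2 * d.natDegree + 7 * h) ?_ (by omega))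
    · linear_combination -hfin
    · compute_degree
      norm_num
      omega
  have hs2 : s ^ 2 - 4 * d * r ^ 2 * q ^ 2 = 0 := by
    rw [hz] at hfin
    exact (mul_eq_zero.mp hfin).resolve_left (pow_ne_zero 2 hB0)
  have hse : s = 2 * q ^ 2 * e := by
    apply mul_left_cancel₀ hdr
    have : (4 : F[X]) ≠ 0 := by norm_num
    apply mul_left_cancel₀ this
    linear_combination -hz
  have : 4 * q ^ 4 * c = 0 := by
    rw [hse] at hs2
    linear_combination (-1) * hs2 - 4 * q ^ 2 * hrel'
  simp [hq0, hc] at this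

end Core

/-- The quadratic map `x ↦ (x - γ)² + c`. -/
def quadMap {R : Type*} [CommRing R] (γ c x : R) : R := (x - γ) ^ 2 + c

theorem map_iterate_quadMap {R S : Type*} [CommRing R] [CommRing S] (f : R →+* S) (γ c x : R)
    (n : ℕ) : f ((quadMap γ c)^[n] x) = (quadMap (f γ) (f c))^[n] (f x) :=
  Function.Semiconj.iterate_right (f := f) (fun x => by simp [quadMap]) n x

section Primitive
variable {F : Type*} [Field F]

theorem exists_eq_mul_sq_of_odd_rootMultiplicity [IsAlgClosed F] {a P : F[X]} (hP : P ≠ 0)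
    (h : ∀ r, Odd (a.rootMultiplicity r) → P.IsRoot r) :
    ∃ d y : F[X], a = d * y ^ 2 ∧ d.natDegree ≤ P.natDegree := by
  classical
  obtain ⟨s, hs⟩ := IsAlgClosed.exists_pow_nat_eq a.leadingCoeff (n := 2) (by norm_num)
  refine ⟨∏ r ∈ a.roots.toFinset, (X - C r) ^ (a.roots.count r % 2),
    C s * ∏ r ∈ a.roots.toFinset, (X - C r) ^ (a.roots.count r / 2), ?_, ?_⟩
  · have h1 := (IsAlgClosed.splits a).eq_prod_roots
    rw [Finset.prod_multiset_map_count, ← hs, C_pow] at h1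
    rw [mul_pow, ← Finset.prod_pow, mul_left_comm, ← Finset.prod_mul_distrib]
    conv_lhs => rw [h1]
    congr 1
    refine Finset.prod_congr rfl fun r _ => ?_
    rw [← pow_mul, ← pow_add]
    congr 1
    omega
  · have hsub : a.roots.toFinset.filter (fun r => Odd (a.roots.count r)) ⊆ P.roots.toFinset := by
      intro r hr
      rw [Finset.mem_filter, count_roots] at hr
      simpa [hP] using h r hr.2
    calc (∏ r ∈ a.roots.toFinset, (X - C r) ^ (a.roots.count r % 2)).natDegree
        ≤ ∑ r ∈ a.roots.toFinset, ((X - C r) ^ (a.roots.count r % 2)).natDegree :=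
          natDegree_prod_le _ _
      _ = ∑ r ∈ a.roots.toFinset, if Odd (a.roots.count r) then 1 else 0 := by
          refine Finset.sum_congr rfl fun r _ => ?_
          rw [natDegree_pow, natDegree_X_sub_C, mul_one]
          split_ifs with ho
          · exact Nat.odd_iff.mp ho
          · exact Nat.even_iff.mp (Nat.not_odd_iff_even.mp ho)
      _ = (a.roots.toFinset.filter (fun r => Odd (a.roots.count r))).card := by
          rw [Finset.card_filter]
      _ ≤ P.roots.toFinset.card := Finset.card_le_card hsub
      _ ≤ P.roots.card := Multiset.toFinset_card_le _
      _ ≤ P.natDegree := card_roots' P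

theorem natDegree_iterate_quadMap_le {γ c x : F[X]} {h : ℕ} (hγ : γ.natDegree ≤ h)
    (hc : c.natDegree ≤ h) (hx : x.natDegree ≤ h) (n : ℕ) :
    ((quadMap γ c)^[n] x).natDegree ≤ h * 2 ^ n := by
  induction n with
  | zero => simpa using hx
  | succ n ih =>
    rw [Function.iterate_succ_apply', quadMap]
    have h1 : h ≤ h * 2 ^ n := Nat.le_mul_of_pos_right h (by positivity)
    have h2 : h * 2 ^ (n + 1) = 2 * (h * 2 ^ n) := by ring
    compute_degree
    omega

theorem natDegree_iterate_quadMap_sub {γ c : F[X]} (he : 0 < (c - γ).natDegree) (n : ℕ) :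
    ((quadMap γ c)^[n + 1] γ - γ).natDegree = 2 ^ n * (c - γ).natDegree := by
  induction n with
  | zero => simp [quadMap]
  | succ n ih =>
    have h0 : 0 < 2 ^ n * (c - γ).natDegree := by positivity
    have h2 : 2 ^ (n + 1) * (c - γ).natDegree = 2 * (2 ^ n * (c - γ).natDegree) := by ring
    have h3 : 1 * (c - γ).natDegree ≤ 2 ^ n * (c - γ).natDegree :=
      Nat.mul_le_mul_right _ Nat.one_le_two_pow
    rw [Function.iterate_succ_apply', quadMap, add_sub_assoc,
      natDegree_add_eq_left_of_natDegree_lt] <;> rw [natDegree_pow, ih] <;> omega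

theorem eval_iterate_quadMap (γ c x : F[X]) (r : F) (n : ℕ) :
    eval r ((quadMap γ c)^[n] x) = (quadMap (eval r γ) (eval r c))^[n] (eval r x) :=
  map_iterate_quadMap (evalRingHom r) γ c x n

theorem exists_primitive_odd_root_of_natDegree_pos [CharZero F] [IsAlgClosed F] {γ c : F[X]}
    (hγ : ∀ n, 1 ≤ n → (quadMap γ c)^[n] γ ≠ 0) (h0 : ∀ n, 1 ≤ n → (quadMap γ c)^[n] 0 ≠ 0)
    (he : 0 < (c - γ).natDegree) :
    ∃ n₀, ∀ n, n₀ ≤ n → ∃ r, Odd (((quadMap γ c)^[n] γ).rootMultiplicity r) ∧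
      ∀ m, 1 ≤ m → m < n → eval r ((quadMap γ c)^[m] γ) ≠ 0 := by
  set h := max γ.natDegree c.natDegree with hh
  have hγh : γ.natDegree ≤ h := le_max_left _ _
  have hch : c.natDegree ≤ h := le_max_right _ _
  have heh : (c - γ).natDegree ≤ h := (natDegree_sub_le c γ).trans (by omega)
  refine ⟨2 * h + 14, fun n hn => ?_⟩
  by_contra! hcon
  set P : F[X] := ∏ j ∈ Finset.range (n / 2),
    ((quadMap γ c)^[j + 1] γ * (quadMap γ c)^[j + 1] 0) with hP
  have hP0 : P ≠ 0 := Finset.prod_ne_zero_iff.mpr fun j _ =>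
    mul_ne_zero (hγ _ (by omega)) (h0 _ (by omega))
  have hPdeg : ∀ m, (∏ j ∈ Finset.range m,
      ((quadMap γ c)^[j + 1] γ * (quadMap γ c)^[j + 1] 0)).natDegree ≤ 4 * (h * 2 ^ m) := by
    intro m
    induction m with
    | zero => simp
    | succ m ih =>
      rw [Finset.prod_range_succ]
      have h1 := natDegree_iterate_quadMap_le hγh hch hγh (m + 1)
      have h2 := natDegree_iterate_quadMap_le hγh hch (x := 0) (by simp) (m + 1)
      have h3 : h * 2 ^ (m + 1) = 2 * (h * 2 ^ m) := by ring
      refine natDegree_mul_le.trans ((Nat.add_le_add ih natDegree_mul_le).trans ?_)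
      omega
  obtain ⟨d, y, hdy, hd⟩ := exists_eq_mul_sq_of_odd_rootMultiplicity (a := (quadMap γ c)^[n] γ) hP0
    (fun r hr => by
      obtain ⟨m, hm1, hmn, hm⟩ := hcon r hr
      have hroot : eval r ((quadMap γ c)^[n] γ) = 0 := by
        have : 0 < ((quadMap γ c)^[n] γ).rootMultiplicity r := hr.pos
        exact (rootMultiplicity_pos'.mp this).2
      have hroot' : eval r ((quadMap γ c)^[n - m] 0) = 0 := by
        have h1 : (quadMap γ c)^[n] γ = (quadMap γ c)^[n - m] ((quadMap γ c)^[m] γ) := by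
          rw [← Function.iterate_add_apply, Nat.sub_add_cancel hmn.le]
        rw [h1, eval_iterate_quadMap, hm] at hroot
        rw [eval_iterate_quadMap, eval_zero, hroot]
      rw [IsRoot.def, hP, eval_prod, Finset.prod_eq_zero_iff]
      rcases le_or_gt m (n / 2) with hle | hlt
      · refine ⟨m - 1, Finset.mem_range.mpr (by omega), ?_⟩
        rw [Nat.sub_add_cancel hm1, eval_mul, hm, zero_mul]
      · refine ⟨n - m - 1, Finset.mem_range.mpr (by omega), ?_⟩
        rw [Nat.sub_add_cancel (by omega : 1 ≤ n - m), eval_mul, hroot', mul_zero])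
  have hdP := hd.trans (hPdeg (n / 2))
  obtain ⟨j, rfl⟩ : ∃ j, n = j + 1 + 2 := ⟨n - 3, by omega⟩
  have hstep : ∀ x, quadMap γ c x - γ = (x - γ) ^ 2 + (c - γ) := fun x => by
    rw [quadMap]; ring
  have hB : ((quadMap γ c)^[j + 1] γ - γ).natDegree ≤ 2 * d.natDegree + 7 * h := by
    refine natDegree_le_of_quartic_eq_mul_sq (e := c - γ) (c := c) (y := y) ?_ ?_ hch heh ?_
    · simpa [quadMap] using hγ 1 le_rfl
    · simpa [quadMap] using hγ 2 (by norm_num)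
    · rw [← hdy, Function.iterate_succ_apply' _ (j + 1 + 1), Function.iterate_succ_apply' _ (j + 1),
        ← hstep]
      rfl
  rw [natDegree_iterate_quadMap_sub he] at hB
  set m := (j + 1 + 2) / 2 with hm
  obtain ⟨i, hi⟩ : ∃ i, j = m + (h + 4 + i) := ⟨j - m - h - 4, by omega⟩
  have h1 : h * 2 ^ m < 2 ^ h * 2 ^ m :=
    Nat.mul_lt_mul_of_pos_right h.lt_two_pow_self (by positivity)
  have h2 : h ≤ h * 2 ^ m := Nat.le_mul_of_pos_right h (by positivity)
  have h3 : 16 * (2 ^ h * 2 ^ m) ≤ 2 ^ j := by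
    rw [hi, show 16 * (2 ^ h * 2 ^ m) = 2 ^ (m + (h + 4)) by ring]
    exact Nat.pow_le_pow_right (by norm_num) (by omega)
  have h4 : 2 ^ j ≤ 2 ^ j * (c - γ).natDegree := Nat.le_mul_of_pos_right _ he
  omega

theorem natDegree_iterate_quadMap_sub_eq_zero {γ c : F[X]} (he : (c - γ).natDegree = 0) (n : ℕ) :
    ((quadMap γ c)^[n] γ - γ).natDegree = 0 := by
  induction n with
  | zero => simp
  | succ n ih =>
    rw [Function.iterate_succ_apply', quadMap, add_sub_assoc, ← Nat.le_zero]
    exact (natDegree_add_le _ _).trans (by rw [natDegree_pow, ih, he]; simp)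

theorem exists_primitive_odd_root_of_natDegree_eq_zero [CharZero F] [IsAlgClosed F] {γ c : F[X]}
    (hinj : Function.Injective fun n => (quadMap γ c)^[n] γ)
    (he : (c - γ).natDegree = 0) (hdeg : 0 < γ.natDegree) :
    ∃ n₀, ∀ n, n₀ ≤ n → ∃ r, Odd (((quadMap γ c)^[n] γ).rootMultiplicity r) ∧
      ∀ m, 1 ≤ m → m < n → eval r ((quadMap γ c)^[m] γ) ≠ 0 := by
  have hconst : ∀ n, ∃ b, (quadMap γ c)^[n] γ = γ + C b := fun n =>
    ⟨_, eq_add_of_sub_eq' (eq_C_of_natDegree_eq_zero (natDegree_iterate_quadMap_sub_eq_zero he n))⟩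
  choose b hb using hconst
  have hbinj : Function.Injective b := fun m n hmn => hinj (by simp only [hb, hmn])
  have hsq : ∀ n, (¬ ∃ r, Odd (((quadMap γ c)^[n] γ).rootMultiplicity r) ∧
      ∀ m, 1 ≤ m → m < n → eval r ((quadMap γ c)^[m] γ) ≠ 0) →
      ∃ (s : F) (y : F[X]), γ + C (b n) = C s * y ^ 2 := by
    intro n hcon
    push Not at hcon
    obtain ⟨d, y, hdy, hd⟩ := exists_eq_mul_sq_of_odd_rootMultiplicity (P := 1)
      (a := (quadMap γ c)^[n] γ) one_ne_zero (fun r hr => by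
        obtain ⟨m, -, hmn, hm⟩ := hcon r hr
        have hroot : eval r ((quadMap γ c)^[n] γ) = 0 := (rootMultiplicity_pos'.mp hr.pos).2
        rw [hb, eval_add, eval_C] at hm hroot
        exact absurd (hbinj (add_left_cancel (hm.trans hroot.symm))) hmn.ne)
    rw [natDegree_one, Nat.le_zero] at hd
    exact ⟨d.coeff 0, y, by rw [← eq_C_of_natDegree_eq_zero hd, ← hdy, hb]⟩
  have hγ' : derivative γ ≠ 0 := fun h => hdeg.ne' (derivative_eq_zero.mp h)
  have hdvd : ∀ {s b : F} {y : F[X]}, γ + C b = C s * y ^ 2 → y ∣ derivative γ ∧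
      2 * y.natDegree = γ.natDegree := by
    intro s b y h
    constructor
    · have h1 := congrArg derivative h
      rw [derivative_add, derivative_C, add_zero, derivative_C_mul, derivative_sq] at h1
      exact ⟨C s * (C 2 * derivative y), by rw [h1]; ring⟩
    · have h1 := congrArg natDegree h
      rw [natDegree_add_C] at h1
      have hs : s ≠ 0 := by rintro rfl; simp at h1; omega
      rw [natDegree_C_mul hs, natDegree_pow] at h1
      exact h1.symm
  by_contra! hcon
  obtain ⟨m, -, hm⟩ := hcon 0
  obtain ⟨n, hmn, hn⟩ := hcon (m + 1)
  obtain ⟨s, y, hy⟩ := hsq m (by push Not; exact hm)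
  obtain ⟨s', y', hy'⟩ := hsq n (by push Not; exact hn)
  have hne : b m - b n ≠ 0 := sub_ne_zero.mpr (hbinj.ne (by omega))
  have hcop : IsCoprime y y' := by
    refine ⟨C (b m - b n)⁻¹ * C s * y, -(C (b m - b n)⁻¹ * C s' * y'), ?_⟩
    have h1 : C (b m - b n)⁻¹ * (C (b m) - C (b n)) = (1 : F[X]) := by
      rw [← C_sub, ← C_mul, inv_mul_cancel₀ hne, C_1]
    linear_combination h1 - C (b m - b n)⁻¹ * hy + C (b m - b n)⁻¹ * hy'
  have hprod := natDegree_le_of_dvd (hcop.mul_dvd (hdvd hy).1 (hdvd hy').1) hγ'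
  have h0 : ∀ {y : F[X]}, y ∣ derivative γ → y ≠ 0 := fun h => ne_zero_of_dvd_ne_zero hγ' h
  rw [natDegree_mul (h0 (hdvd hy).1) (h0 (hdvd hy').1)] at hprod
  have := natDegree_derivative_le γ
  have := (hdvd hy).2
  have := (hdvd hy').2
  omega

theorem exists_primitive_odd_root [CharZero F] [IsAlgClosed F] {γ c : F[X]}
    (hγ : ∀ n, 1 ≤ n → (quadMap γ c)^[n] γ ≠ 0) (h0 : ∀ n, 1 ≤ n → (quadMap γ c)^[n] 0 ≠ 0)
    (hinj : Function.Injective fun n => (quadMap γ c)^[n] γ)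
    (hdeg : 0 < max γ.natDegree c.natDegree) :
    ∃ n₀, ∀ n, n₀ ≤ n → ∃ r, Odd (((quadMap γ c)^[n] γ).rootMultiplicity r) ∧
      ∀ m, 1 ≤ m → m < n → eval r ((quadMap γ c)^[m] γ) ≠ 0 := by
  rcases Nat.eq_zero_or_pos (c - γ).natDegree with he | he
  · refine exists_primitive_odd_root_of_natDegree_eq_zero hinj he ?_
    have h1 : c = γ + (c - γ) := by ring
    have h2 : c.natDegree ≤ max γ.natDegree (c - γ).natDegree := by
      conv_lhs => rw [h1]
      exact natDegree_add_le _ _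
    omega
  · exact exists_primitive_odd_root_of_natDegree_pos hγ h0 he

end Primitive

section Iterate
variable {R : Type*} [CommRing R]

/-- The polynomial `(X - γ)² + c`. -/
noncomputable def quadPoly (γ c : R) : R[X] := (X - C γ) ^ 2 + C c

/-- The `n`-th iterate of the polynomial `(X - γ)² + c` under composition. -/
noncomputable def quadIter (γ c : R) (n : ℕ) : R[X] :=
  (fun p => p.comp (quadPoly γ c))^[n] X

theorem quadIter_zero (γ c : R) : quadIter γ c 0 = X := rfl

theorem quadIter_succ (γ c : R) (n : ℕ) :
    quadIter γ c (n + 1) = (quadIter γ c n).comp (quadPoly γ c) :=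
  Function.iterate_succ_apply' _ n X

theorem eval_quadPoly (γ c x : R) : (quadPoly γ c).eval x = quadMap γ c x := by
  simp [quadPoly, quadMap]

theorem eval_quadIter (γ c x : R) (n : ℕ) : (quadIter γ c n).eval x = (quadMap γ c)^[n] x := by
  induction n generalizing x with
  | zero => simp [quadIter_zero]
  | succ n ih => rw [quadIter_succ, eval_comp, eval_quadPoly, ih, Function.iterate_succ_apply]

theorem map_quadIter {S : Type*} [CommRing S] (f : R →+* S) (γ c : R) (n : ℕ) :
    (quadIter γ c n).map f = quadIter (f γ) (f c) n := by
  induction n with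
  | zero => simp [quadIter_zero]
  | succ n ih => rw [quadIter_succ, quadIter_succ, map_comp, ih]; simp [quadPoly]

theorem aeval_quadIter {A : Type*} [CommRing A] [Algebra R A] (γ c : R) (x : A) (n : ℕ) :
    aeval x (quadIter γ c n) = (quadMap (algebraMap R A γ) (algebraMap R A c))^[n] x := by
  rw [← eval_map_algebraMap, map_quadIter, eval_quadIter]

theorem quadPoly_eq (γ c : R) :
    quadPoly γ c = X ^ 2 + (C (-2 * γ) * X + C (γ ^ 2 + c)) := by
  simp only [quadPoly, map_add, map_mul, map_neg, map_pow, map_ofNat]; ring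

theorem monic_quadPoly (γ c : R) : (quadPoly γ c).Monic := by
  rw [quadPoly_eq]
  exact monic_X_pow_add (degree_linear_lt)

theorem natDegree_quadPoly [Nontrivial R] (γ c : R) : (quadPoly γ c).natDegree = 2 := by
  rw [quadPoly]
  compute_degree!

theorem monic_quadIter [Nontrivial R] [NoZeroDivisors R] (γ c : R) (n : ℕ) :
    (quadIter γ c n).Monic := by
  induction n with
  | zero => exact monic_X
  | succ n ih =>
    rw [quadIter_succ]
    exact ih.comp (monic_quadPoly γ c) (by rw [natDegree_quadPoly]; norm_num)

theorem natDegree_quadIter [Nontrivial R] [NoZeroDivisors R] (γ c : R) (n : ℕ) :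
    (quadIter γ c n).natDegree = 2 ^ n := by
  induction n with
  | zero => exact natDegree_X
  | succ n ih => rw [quadIter_succ, natDegree_comp, ih, natDegree_quadPoly, pow_succ]

theorem eval_derivative_quadIter_ne_zero {F : Type*} [Field F] [CharZero F] {γ c : F} {n : ℕ}
    (h : ∀ m, 1 ≤ m → m ≤ n → (quadMap γ c)^[m] γ ≠ 0) {x : F} (hx : (quadMap γ c)^[n] x = 0) :
    (derivative (quadIter γ c n)).eval x ≠ 0 := by
  induction n generalizing x with
  | zero => simp [quadIter_zero]
  | succ n ih =>
    have h1 : x - γ ≠ 0 := by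
      intro h0
      rw [sub_eq_zero.mp h0] at hx
      exact h _ (by omega) le_rfl hx
    rw [quadIter_succ, derivative_comp, eval_mul, eval_comp, eval_quadPoly]
    refine mul_ne_zero ?_ (ih (fun m h1 h2 => h m h1 (by omega)) ?_)
    · simpa [quadPoly, derivative_sq] using h1
    · rwa [Function.iterate_succ_apply] at hx

end Iterate

section PowerSeries
variable {κ : Type*} [Field κ]

theorem exists_powerSeries_root_of_eval_derivative_ne_zero {f : (PowerSeries κ)[X]}
    (hf : f.Monic) {a : κ}
    (ha : (f.map PowerSeries.constantCoeff).eval a = 0)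
    (ha' : (derivative (f.map PowerSeries.constantCoeff)).eval a ≠ 0) :
    ∃ r : PowerSeries κ, f.IsRoot r ∧ PowerSeries.constantCoeff r = a := by
  have hcc : ∀ p : (PowerSeries κ)[X], PowerSeries.constantCoeff (p.eval (PowerSeries.C a)) =
      (p.map PowerSeries.constantCoeff).eval a := fun p => by
    rw [eval_map, ← eval₂_hom, PowerSeries.constantCoeff_C]
  obtain ⟨r, hr, hra⟩ := HenselianRing.is_henselian
    (I := Ideal.span {(PowerSeries.X : PowerSeries κ)}) f hf
    (PowerSeries.C a)
    (by rw [Ideal.mem_span_singleton, PowerSeries.X_dvd_iff, hcc, ha])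
    (by
      refine IsUnit.map _ ?_
      rw [PowerSeries.isUnit_iff_constantCoeff, hcc, isUnit_iff_ne_zero, ← derivative_map]
      exact ha')
  refine ⟨r, hr, ?_⟩
  rw [Ideal.mem_span_singleton, PowerSeries.X_dvd_iff, map_sub, PowerSeries.constantCoeff_C] at hra
  exact sub_eq_zero.mp hra

theorem exists_powerSeries_sq_eq [CharZero κ] [IsAlgClosed κ] {a : PowerSeries κ}
    (ha : PowerSeries.constantCoeff a ≠ 0) : ∃ z, z ^ 2 = a := by
  obtain ⟨s, hs⟩ := IsAlgClosed.exists_pow_nat_eq (PowerSeries.constantCoeff a)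
    (n := 2) (by norm_num)
  have hs0 : s ≠ 0 := by rintro rfl; simp at hs; exact ha hs.symm
  obtain ⟨r, hr, -⟩ := exists_powerSeries_root_of_eval_derivative_ne_zero (f := X ^ 2 - C a)
    (a := s) (monic_X_pow_sub_C a (by norm_num)) (by simp [hs]) (by simp [derivative_sq, hs0])
  exact ⟨r, by simpa [sub_eq_zero] using hr⟩

theorem even_of_powerSeries_sq_eq_X_pow_mul {z u : PowerSeries κ} {m : ℕ} (hu : IsUnit u)
    (h : z ^ 2 = PowerSeries.X ^ m * u) : Even m := by
  have h1 := congrArg PowerSeries.order h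
  rw [PowerSeries.order_pow, PowerSeries.order_mul, PowerSeries.order_X_pow,
    PowerSeries.order_zero_of_unit hu, add_zero, nsmul_eq_mul] at h1
  have hz : z.order ≠ ⊤ := by
    intro ht
    rw [ht] at h1
    exact absurd h1 (by simp)
  lift z.order to ℕ using hz with l
  exact ⟨l, by have : 2 * l = m := by exact_mod_cast h1
               omega⟩

theorem exists_isRoot_quadIter_powerSeries [CharZero κ] [IsAlgClosed κ]
    {γ c : PowerSeries κ} {N m : ℕ}
    (hunit : ∀ i, 1 ≤ i → i ≤ N → PowerSeries.constantCoeff ((quadMap γ c)^[i] γ) ≠ 0)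
    {u : PowerSeries κ} (hu : IsUnit u) (hm : Odd m)
    (hodd : (quadMap γ c)^[N + 1] γ = PowerSeries.X ^ m * u) :
    (quadIter γ c N).roots.card = (quadIter γ c N).natDegree ∧
    ∃ β, (quadIter γ c N).IsRoot β ∧
      (∀ r, (quadIter γ c N).IsRoot r → r ≠ β → ∃ z, z ^ 2 = r - c) ∧
      ∀ z, z ^ 2 ≠ β - c := by
  classical
  set f := quadIter γ c N with hf
  have hfm : f.Monic := monic_quadIter γ c N
  set g := f.map PowerSeries.constantCoeff with hg
  have hg' : g = quadIter (PowerSeries.constantCoeff γ) (PowerSeries.constantCoeff c) N :=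
    map_quadIter _ γ c N
  have hgm : g.Monic := hfm.map _
  have hder : ∀ a, g.eval a = 0 → (derivative g).eval a ≠ 0 := by
    intro a ha
    rw [hg'] at ha ⊢
    refine eval_derivative_quadIter_ne_zero (fun i h1 h2 => ?_) (by rwa [eval_quadIter] at ha)
    rw [← map_iterate_quadMap]
    exact hunit i h1 h2
  have hlift : ∀ a, ∃ r : PowerSeries κ,
      g.eval a = 0 → f.IsRoot r ∧ PowerSeries.constantCoeff r = a := fun a => by
    by_cases ha : g.eval a = 0
    · obtain ⟨r, hr⟩ := exists_powerSeries_root_of_eval_derivative_ne_zero hfm ha (hder a ha)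
      exact ⟨r, fun _ => hr⟩
    · exact ⟨0, fun h => absurd h ha⟩
  choose lift hl using hlift
  have hsep : g.roots.Nodup := by
    rw [Multiset.nodup_iff_count_le_one]
    intro a
    rw [count_roots]
    by_contra! h1
    have := (one_lt_rootMultiplicity_iff_isRoot hgm.ne_zero).mp h1
    exact hder a this.1 this.2
  have hgcard : g.roots.card = f.natDegree := by
    rw [← hfm.natDegree_map (PowerSeries.constantCoeff (R := κ)), ← hg]
    exact (IsAlgClosed.splits g).natDegree_eq_card_roots.symm
  have hinj : ∀ a ∈ g.roots, ∀ b ∈ g.roots, lift a = lift b → a = b := by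
    intro a ha b hb hab
    rw [← (hl a (isRoot_of_mem_roots ha)).2, ← (hl b (isRoot_of_mem_roots hb)).2, hab]
  have hle : g.roots.map lift ≤ f.roots := by
    refine (Multiset.le_iff_subset (hsep.map_on hinj)).mpr fun r hr => ?_
    obtain ⟨a, ha, rfl⟩ := Multiset.mem_map.mp hr
    exact (mem_roots hfm.ne_zero).mpr (hl a (isRoot_of_mem_roots ha)).1
  have hroots : g.roots.map lift = f.roots :=
    Multiset.eq_of_le_of_card_le hle (by rw [Multiset.card_map, hgcard]; exact card_roots' f)
  have hcard : f.roots.card = f.natDegree := by rw [← hroots, Multiset.card_map, hgcard]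
  have hprod : f.eval c = (g.roots.map fun a => c - lift a).prod := by
    conv_lhs => rw [← prod_multiset_X_sub_C_of_monic_of_roots_card_eq hfm hcard, ← hroots]
    rw [Multiset.map_map, eval_multiset_prod, Multiset.map_map]
    simp
  have hfc : f.eval c = PowerSeries.X ^ m * u := by
    rw [← hodd, hf, eval_quadIter, Function.iterate_succ_apply]
    simp [quadMap]
  set a₀ := PowerSeries.constantCoeff c with ha₀
  have hmem : a₀ ∈ g.roots := by
    rw [mem_roots hgm.ne_zero, IsRoot.def, hg, ha₀, eval_map, eval₂_hom, hfc]
    simp [hm.pos.ne']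
  refine ⟨hcard, lift a₀, (hl a₀ (isRoot_of_mem_roots hmem)).1, fun r hr hne => ?_, fun z hz => ?_⟩
  · obtain ⟨a, ha, rfl⟩ := Multiset.mem_map.mp
      (hroots.symm ▸ (mem_roots hfm.ne_zero).mpr hr : r ∈ g.roots.map lift)
    refine exists_powerSeries_sq_eq ?_
    rw [map_sub, (hl a (isRoot_of_mem_roots ha)).2, ← ha₀, sub_ne_zero]
    rintro rfl
    exact hne rfl
  · obtain ⟨t, ht⟩ := Multiset.exists_cons_of_mem hmem
    rw [ht, Multiset.map_cons, Multiset.prod_cons, hfc] at hprod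
    have hw : IsUnit (t.map fun a => c - lift a).prod := by
      rw [PowerSeries.isUnit_iff_constantCoeff, map_multiset_prod, Multiset.map_map,
        isUnit_iff_ne_zero, Ne, Multiset.prod_eq_zero_iff]
      intro h0
      obtain ⟨a, ha, ha'⟩ := Multiset.mem_map.mp h0
      have hag : a ∈ g.roots := by rw [ht]; exact Multiset.mem_cons_of_mem ha
      rw [Function.comp_apply, map_sub, (hl a (isRoot_of_mem_roots hag)).2, ← ha₀, sub_eq_zero]
        at ha'
      rw [ht, Multiset.nodup_cons, ha'] at hsep
      exact hsep.1 ha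
    obtain ⟨w, hw⟩ := hw
    rw [← hw] at hprod
    refine Nat.not_even_iff_odd.mpr hm (even_of_powerSeries_sq_eq_X_pow_mul
      (hu.mul (w⁻¹).isUnit).neg (z := z) ?_)
    rw [hz, mul_neg, ← mul_assoc, hprod, mul_assoc, Units.mul_inv]
    ring

end PowerSeries

section Taylor
variable {κ : Type*} [Field κ]

/-- Expansion of polynomials into power series at the point `r`. -/
noncomputable def expandAt (r : κ) : κ[X] →+* PowerSeries κ :=
  eval₂RingHom PowerSeries.C (PowerSeries.X + PowerSeries.C r)

theorem constantCoeff_expandAt (r : κ) (p : κ[X]) :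
    PowerSeries.constantCoeff (expandAt r p) = p.eval r := by
  have : (PowerSeries.constantCoeff).comp (expandAt r) = evalRingHom r := by
    ext <;> simp [expandAt]
  exact congrArg (fun f => f p) this

theorem exists_expandAt_eq {r : κ} {p : κ[X]} (hp : p ≠ 0) :
    ∃ u, IsUnit u ∧ expandAt r p = PowerSeries.X ^ p.rootMultiplicity r * u := by
  obtain ⟨q, hq, hdvd⟩ := exists_eq_pow_rootMultiplicity_mul_and_not_dvd p hp r
  refine ⟨expandAt r q, ?_, ?_⟩
  · rwa [PowerSeries.isUnit_iff_constantCoeff, constantCoeff_expandAt, isUnit_iff_ne_zero, Ne,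
      ← IsRoot.def, ← dvd_iff_isRoot]
  · conv_lhs => rw [hq]
    rw [map_mul, map_pow]
    congr 2
    simp [expandAt]

theorem expandAt_injective (r : κ) : Function.Injective (expandAt r) := by
  refine (injective_iff_map_eq_zero _).mpr fun p hp => ?_
  by_contra h
  obtain ⟨u, hu, he⟩ := exists_expandAt_eq (r := r) h
  rw [hp] at he
  exact mul_ne_zero (pow_ne_zero _ PowerSeries.X_ne_zero) hu.ne_zero he.symm

end Taylor

section Degree
open IntermediateField

theorem sqrt_notMem_adjoin {K κ H Ω : Type*} [Field K] [Field κ] [CharZero κ] [IsAlgClosed κ]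
    [Field H] [Algebra (PowerSeries κ) H] [IsFractionRing (PowerSeries κ) H] [Field Ω] [Algebra K Ω]
    [Algebra.IsAlgebraic K Ω] (j : K →+* H) {γ c : K} {γ' c' : PowerSeries κ}
    (hγ : j γ = algebraMap (PowerSeries κ) H γ') (hc : j c = algebraMap (PowerSeries κ) H c')
    {N m : ℕ} (hirr : Irreducible (quadIter γ c N))
    (hunit : ∀ i, 1 ≤ i → i ≤ N → PowerSeries.constantCoeff ((quadMap γ' c')^[i] γ') ≠ 0)
    {u : PowerSeries κ} (hu : IsUnit u) (hm : Odd m)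
    (hodd : (quadMap γ' c')^[N + 1] γ' = PowerSeries.X ^ m * u)
    {α : Ω} (hα : α ∈ (quadIter γ c N).rootSet Ω)
    {y : Ω → Ω} (hy : ∀ β, y β ^ 2 = β - algebraMap K Ω c) :
    y α ∉ adjoin K ((quadIter γ c N).rootSet Ω ∪ y '' ((quadIter γ c N).rootSet Ω \ {α})) := by
  obtain ⟨hcard, β, hβ, hsq, hnsq⟩ := exists_isRoot_quadIter_powerSeries hunit hu hm hodd
  let _ : Algebra K H := j.toAlgebra
  set Λ := AlgebraicClosure H
  set ι : PowerSeries κ →+* Λ := (algebraMap H Λ).comp (algebraMap (PowerSeries κ) H) with hι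
  have hιinj : Function.Injective ι :=
    (algebraMap H Λ).injective.comp (IsFractionRing.injective (PowerSeries κ) H)
  have hmapj : ∀ x, algebraMap K Λ x = algebraMap H Λ (j x) := fun x =>
    IsScalarTower.algebraMap_apply K H Λ x
  have hιγ : algebraMap K Λ γ = ι γ' := by rw [hmapj, hγ]; rfl
  have hιc : algebraMap K Λ c = ι c' := by rw [hmapj, hc]; rfl
  have hmap : (quadIter γ c N).map (algebraMap K Λ) = (quadIter γ' c' N).map ι := by
    rw [map_quadIter, map_quadIter, hιγ, hιc]
  have hmin : minpoly K α = quadIter γ c N :=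
    (minpoly.eq_of_irreducible_of_monic hirr (aeval_eq_zero_of_mem_rootSet hα)
      (monic_quadIter γ c N)).symm
  obtain ⟨J, hJ⟩ := exists_algHom_of_splits_of_aeval (F := K) (E := Ω) (K := Λ) (x := α) (y := ι β)
    (fun s => ⟨Algebra.IsIntegral.isIntegral s, IsAlgClosed.splits _⟩)
    (by rw [hmin, ← eval_map_algebraMap, hmap, eval_map, eval₂_hom, hβ.eq_zero, map_zero])
  have hroot : ∀ x ∈ (quadIter γ c N).rootSet Ω,
      ∃ r, (quadIter γ' c' N).IsRoot r ∧ J x = ι r := by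
    intro x hx
    have h1 : ((quadIter γ' c' N).map ι).IsRoot (J x) := by
      rw [← hmap, IsRoot.def, eval_map_algebraMap, aeval_algHom_apply,
        aeval_eq_zero_of_mem_rootSet hx, map_zero]
    have h2 : J x ∈ ((quadIter γ' c' N).map ι).roots :=
      (mem_roots ((monic_quadIter γ' c' N).map ι).ne_zero).mpr h1
    rw [← roots_map_of_injective_of_card_eq_natDegree hιinj hcard] at h2
    obtain ⟨r, hr, hrx⟩ := Multiset.mem_map.mp h2
    exact ⟨r, isRoot_of_mem_roots hr, hrx.symm⟩
  have hJy : ∀ x, J (y x) ^ 2 = J x - ι c' := fun x => by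
    rw [← map_pow, hy, map_sub, AlgHom.commutes, hιc]
  have hle : adjoin K ((quadIter γ c N).rootSet Ω ∪ y '' ((quadIter γ c N).rootSet Ω \ {α})) ≤
      (IsScalarTower.toAlgHom K H Λ).fieldRange.comap J := by
    rw [adjoin_le_iff]
    rintro x (hx | ⟨x, ⟨hx, hxα⟩, rfl⟩)
    · obtain ⟨r, -, hr⟩ := hroot x hx
      exact ⟨algebraMap _ H r, hr.symm⟩
    · obtain ⟨r, hr, hxr⟩ := hroot x hx
      have hrβ : r ≠ β := by
        rintro rfl
        exact hxα (J.injective (hxr.trans hJ.symm))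
      obtain ⟨z, hz⟩ := hsq r hr hrβ
      have h1 : J (y x) ^ 2 = ι z ^ 2 := by rw [hJy, hxr, ← map_sub, ← hz, map_pow]
      rcases sq_eq_sq_iff_eq_or_eq_neg.mp h1 with h2 | h2
      · exact ⟨algebraMap _ H z, h2.symm⟩
      · exact ⟨algebraMap _ H (-z), by rw [← map_neg] at h2; exact h2.symm⟩
  intro hmem
  obtain ⟨w, hw⟩ := hle hmem
  have hw' : algebraMap H Λ w = J (y α) := hw
  have hw2 : w ^ 2 = algebraMap _ H (β - c') := by
    apply (algebraMap H Λ).injective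
    rw [map_pow, hw', hJy, hJ, ← map_sub]
    rfl
  have hw_int : IsIntegral (PowerSeries κ) w :=
    IsIntegral.of_pow (n := 2) (by norm_num) (by rw [hw2]; exact isIntegral_algebraMap)
  obtain ⟨z, rfl⟩ := IsIntegrallyClosed.isIntegral_iff.mp hw_int
  rw [← map_pow] at hw2
  exact hnsq z (IsFractionRing.injective (PowerSeries κ) H hw2)

variable {K Ω : Type*} [Field K] [Field Ω] [Algebra K Ω]

theorem two_mul_finrank_le_of_lt {E F : IntermediateField K Ω} (h : E < F)
    [FiniteDimensional K F] : 2 * Module.finrank K E ≤ Module.finrank K F := by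
  have h1 := finrank_bot_mul_relfinrank h.le
  have h2 : Module.finrank K E ≠ Module.finrank K F := fun he =>
    h.ne (eq_of_le_of_finrank_eq h.le he)
  have h3 : 0 < Module.finrank K F := Module.finrank_pos
  have h4 : relfinrank E F ≠ 0 := fun h0 => by rw [h0] at h1; omega
  have h5 : relfinrank E F ≠ 1 := fun h0 => by rw [h0] at h1; omega
  rw [← h1, mul_comm]
  exact Nat.mul_le_mul_left _ (by omega)

theorem two_pow_card_mul_finrank_adjoin_le [Algebra.IsAlgebraic K Ω] {S : Set Ω} (hS : S.Finite)
    {T : Finset Ω} {y : Ω → Ω} (hy : ∀ α ∈ T, y α ∉ adjoin K (S ∪ y '' ((T : Set Ω) \ {α}))) :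
    2 ^ T.card * Module.finrank K (adjoin K S) ≤ Module.finrank K (adjoin K (S ∪ y '' T)) := by
  classical
  suffices H : ∀ U : Finset Ω, U ⊆ T →
      2 ^ U.card * Module.finrank K (adjoin K S) ≤ Module.finrank K (adjoin K (S ∪ y '' U)) from
    H T subset_rfl
  intro U
  induction U using Finset.induction_on with
  | empty => intro _; rw [Finset.coe_empty, Set.image_empty, Set.union_empty]; simp
  | insert α U hα ih =>
    intro hU
    have : Finite ↑(S ∪ y '' ((insert α U : Finset Ω) : Set Ω)) :=
      (hS.union ((Finset.finite_toSet _).image y)).to_subtype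
    have : FiniteDimensional K (adjoin K (S ∪ y '' ((insert α U : Finset Ω) : Set Ω))) :=
      finiteDimensional_adjoin fun _ _ => Algebra.IsIntegral.isIntegral _
    have hlt : adjoin K (S ∪ y '' (U : Set Ω)) <
        adjoin K (S ∪ y '' ((insert α U : Finset Ω) : Set Ω)) := by
      refine lt_of_le_of_ne (adjoin.mono _ _ _ ?_) fun he => ?_
      · gcongr
        simp
      · refine hy α (hU (Finset.mem_insert_self α U)) ?_
        have h1 : y α ∈ adjoin K (S ∪ y '' ((insert α U : Finset Ω) : Set Ω)) :=
          subset_adjoin _ _ (Or.inr ⟨α, by simp, rfl⟩)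
        rw [← he] at h1
        refine adjoin.mono _ _ _ ?_ h1
        gcongr
        intro x hx
        exact ⟨hU (Finset.mem_insert_of_mem hx), fun hxa => hα (hxa ▸ hx)⟩
    have h2 := ih ((Finset.subset_insert α U).trans hU)
    have h3 := two_mul_finrank_le_of_lt hlt
    rw [Finset.card_insert_of_notMem hα, pow_succ]
    linarith

theorem two_pow_mul_finrank_adjoin_rootSet_le [CharZero K] [Algebra.IsAlgebraic K Ω]
    [IsAlgClosed Ω] {γ c : K} {N : ℕ} (hirr : Irreducible (quadIter γ c N))
    (h : ∀ y : Ω → Ω, (∀ β, y β ^ 2 = β - algebraMap K Ω c) →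
      ∀ α ∈ (quadIter γ c N).rootSet Ω, y α ∉ adjoin K ((quadIter γ c N).rootSet Ω ∪
        y '' ((quadIter γ c N).rootSet Ω \ {α}))) :
    2 ^ 2 ^ N * Module.finrank K (adjoin K ((quadIter γ c N).rootSet Ω)) ≤
      Module.finrank K (adjoin K ((quadIter γ c (N + 1)).rootSet Ω)) := by
  classical
  have hsqrt : ∀ β : Ω, ∃ z, z ^ 2 = β - algebraMap K Ω c := fun β =>
    IsAlgClosed.exists_pow_nat_eq _ (by norm_num)
  choose y hy using hsqrt
  set S := (quadIter γ c N).rootSet Ω with hS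
  have hcard : S.toFinset.card = 2 ^ N := by
    rw [Set.toFinset_card, card_rootSet_eq_natDegree hirr.separable (IsAlgClosed.splits _),
      natDegree_quadIter]
  have h1 := two_pow_card_mul_finrank_adjoin_le (K := K) (S := S) (T := S.toFinset) (y := y)
    (rootSet_finite _ _) (by
      intro α hα
      rw [Set.coe_toFinset]
      exact h y hy α (Set.mem_toFinset.mp hα))
  rw [hcard, Set.coe_toFinset] at h1
  refine h1.trans ?_
  have : FiniteDimensional K (adjoin K ((quadIter γ c (N + 1)).rootSet Ω)) :=
    finiteDimensional_adjoin fun _ _ => Algebra.IsIntegral.isIntegral _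
  have hmem : ∀ β ∈ S, y β + algebraMap K Ω γ ∈ adjoin K ((quadIter γ c (N + 1)).rootSet Ω) := by
    intro β hβ
    refine subset_adjoin _ _ ?_
    have h2 := aeval_eq_zero_of_mem_rootSet hβ
    rw [mem_rootSet_of_ne (monic_quadIter γ c _).ne_zero, aeval_quadIter,
      Function.iterate_succ_apply]
    rw [aeval_quadIter] at h2
    rw [quadMap, add_sub_cancel_right, hy, sub_add_cancel, h2]
  have hy' : ∀ β ∈ S, y β ∈ adjoin K ((quadIter γ c (N + 1)).rootSet Ω) := fun β hβ => by
    simpa using sub_mem (hmem β hβ) (IntermediateField.algebraMap_mem _ γ)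
  have hle : adjoin K (S ∪ y '' S) ≤ adjoin K ((quadIter γ c (N + 1)).rootSet Ω) := by
    rw [adjoin_le_iff]
    rintro x (hx | ⟨x, hx, rfl⟩)
    · have : x = y x ^ 2 + algebraMap K Ω c := by rw [hy]; ring
      rw [this]
      exact add_mem (pow_mem (hy' x hx) 2) (IntermediateField.algebraMap_mem _ c)
    · exact hy' x hx
  exact finrank_le_of_le_right hle

theorem finrank_adjoin_rootSet [IsAlgClosed Ω] (p : K[X]) :
    Module.finrank K (adjoin K (p.rootSet Ω)) = Module.finrank K p.SplittingField := by
  have := adjoin_rootSet_isSplittingField (K := K) (L := Ω) (p := p) (IsAlgClosed.splits _)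
  exact (IsSplittingField.algEquiv (adjoin K (p.rootSet Ω)) p).toLinearEquiv.finrank_eq

end Degree

section FiniteIndex
variable {k : Type*} [Field k]

theorem iterate_quadMap_ne_zero_of_irreducible {γ c : k[X]} {n : ℕ} (hn : 1 ≤ n)
    (h : Irreducible (quadIter (algebraMap k[X] (RatFunc k) γ) (algebraMap k[X] (RatFunc k) c) n))
    (x : k[X]) : (quadMap γ c)^[n] x ≠ 0 := by
  intro h0
  have hroot : (quadIter (algebraMap k[X] (RatFunc k) γ) (algebraMap k[X] (RatFunc k) c) n).IsRoot
      (algebraMap k[X] (RatFunc k) x) := by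
    rw [IsRoot.def, eval_quadIter, ← map_iterate_quadMap, h0, map_zero]
  have h1 : 2 ^ n = 1 := (natDegree_quadIter _ _ n).symm.trans
    (natDegree_eq_of_degree_eq_some (degree_eq_one_of_irreducible_of_root h hroot))
  have h2 : 2 ^ 1 ≤ 2 ^ n := Nat.pow_le_pow_right (by norm_num) hn
  omega

theorem injective_iterate_of_infinite {α : Type*} {g : α → α} {a : α}
    (h : Set.Infinite {x | ∃ n, 1 ≤ n ∧ g^[n] a = x}) : Function.Injective fun n => g^[n] a := by
  have key : ∀ m n, m < n → g^[m] a ≠ g^[n] a := by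
    intro m n hmn he
    refine h ((Set.finite_range fun i : Fin n => g^[i] a).subset ?_)
    rintro x ⟨i, -, rfl⟩
    induction i using Nat.strong_induction_on with
    | _ i ih =>
      by_cases hi : i < n
      · exact ⟨⟨i, hi⟩, rfl⟩
      · have h1 : g^[i] a = g^[i - n + m] a := by
          rw [Function.iterate_add_apply, he, ← Function.iterate_add_apply,
            Nat.sub_add_cancel (not_lt.mp hi)]
        rw [h1]
        exact ih _ (by omega)
  intro m n he
  rcases lt_trichotomy m n with h1 | h1 | h1
  · exact (key m n h1 he).elim
  · exact h1
  · exact (key n m h1 he.symm).elim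

theorem two_pow_mul_finrank_splittingField_quadIter_le [CharZero k] {γ c : k[X]} {N : ℕ}
    {κ : Type*} [Field κ] [IsAlgClosed κ] [Algebra k κ]
    (hirr : Irreducible
      (quadIter (algebraMap k[X] (RatFunc k) γ) (algebraMap k[X] (RatFunc k) c) N))
    {r : κ} (hodd : Odd (((quadMap (γ.map (algebraMap k κ)) (c.map (algebraMap k κ)))^[N + 1]
      (γ.map (algebraMap k κ))).rootMultiplicity r))
    (hne : ∀ m, 1 ≤ m → m < N + 1 → eval r ((quadMap (γ.map (algebraMap k κ))
      (c.map (algebraMap k κ)))^[m] (γ.map (algebraMap k κ))) ≠ 0) :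
    2 ^ 2 ^ N * Module.finrank (RatFunc k) (quadIter (algebraMap k[X] (RatFunc k) γ)
        (algebraMap k[X] (RatFunc k) c) N).SplittingField ≤
      Module.finrank (RatFunc k) (quadIter (algebraMap k[X] (RatFunc k) γ)
        (algebraMap k[X] (RatFunc k) c) (N + 1)).SplittingField := by
  have : CharZero κ := charZero_of_injective_algebraMap (algebraMap k κ).injective
  set e : k[X] →+* PowerSeries κ := (expandAt r).comp (mapRingHom (algebraMap k κ)) with he
  have heinj : Function.Injective e :=
    (expandAt_injective r).comp (map_injective _ (algebraMap k κ).injective)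
  set H := FractionRing (PowerSeries κ)
  have hinj : Function.Injective ((algebraMap (PowerSeries κ) H).comp e) :=
    (IsFractionRing.injective (PowerSeries κ) H).comp heinj
  set j : RatFunc k →+* H := IsFractionRing.lift hinj
  have hj : ∀ p, j (algebraMap k[X] (RatFunc k) p) = algebraMap (PowerSeries κ) H (e p) :=
    fun p => IsFractionRing.lift_algebraMap hinj p
  have hp0 : (quadMap (γ.map (algebraMap k κ)) (c.map (algebraMap k κ)))^[N + 1]
      (γ.map (algebraMap k κ)) ≠ 0 := fun h0 => by simp [h0] at hodd
  have hexp : ∀ i, (quadMap (e γ) (e c))^[i] (e γ) = expandAt r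
      ((quadMap (γ.map (algebraMap k κ)) (c.map (algebraMap k κ)))^[i]
        (γ.map (algebraMap k κ))) := fun i => (map_iterate_quadMap (expandAt r) _ _ _ i).symm
  obtain ⟨u, hu, hu'⟩ := exists_expandAt_eq (r := r) hp0
  rw [← finrank_adjoin_rootSet (Ω := AlgebraicClosure (RatFunc k)),
    ← finrank_adjoin_rootSet (Ω := AlgebraicClosure (RatFunc k))]
  refine two_pow_mul_finrank_adjoin_rootSet_le hirr fun y hy α hα => ?_
  refine sqrt_notMem_adjoin j (hj γ) (hj c) hirr ?_ hu hodd ((hexp _).trans hu') hα hy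
  intro i hi hiN
  rw [hexp, constantCoeff_expandAt]
  exact hne i hi (by omega)

theorem exists_two_pow_le_mul_finrank_splittingField [CharZero k] {γ c : k[X]}
    (hstable : ∀ n, 1 ≤ n → Irreducible
      (quadIter (algebraMap k[X] (RatFunc k) γ) (algebraMap k[X] (RatFunc k) c) n))
    (hpci : Set.Infinite {x | ∃ n, 1 ≤ n ∧ (quadMap γ c)^[n] γ = x})
    (hht : 0 < max γ.natDegree c.natDegree) :
    ∃ N, 1 ≤ N ∧ ∀ n, 2 ^ 2 ^ n ≤ N * Module.finrank (RatFunc k)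
      (quadIter (algebraMap k[X] (RatFunc k) γ)
        (algebraMap k[X] (RatFunc k) c) n).SplittingField := by
  set κ := AlgebraicClosure k
  have : CharZero κ := charZero_of_injective_algebraMap (algebraMap k κ).injective
  have hinj : Function.Injective (mapRingHom (algebraMap k κ)) :=
    map_injective _ (algebraMap k κ).injective
  have hmap : ∀ x n, (quadMap (γ.map (algebraMap k κ)) (c.map (algebraMap k κ)))^[n]
      (x.map (algebraMap k κ)) = mapRingHom (algebraMap k κ) ((quadMap γ c)^[n] x) := fun x n =>
    (map_iterate_quadMap (mapRingHom (algebraMap k κ)) γ c x n).symm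
  have hne : ∀ x : k[X], ∀ n, 1 ≤ n → (quadMap (γ.map (algebraMap k κ))
      (c.map (algebraMap k κ)))^[n] (x.map (algebraMap k κ)) ≠ 0 := fun x n hn => by
    rw [hmap]
    exact (map_ne_zero_iff _ hinj).mpr (iterate_quadMap_ne_zero_of_irreducible hn (hstable n hn) x)
  obtain ⟨n₀, hn₀⟩ := exists_primitive_odd_root (F := κ) (γ := γ.map (algebraMap k κ))
    (c := c.map (algebraMap k κ)) (hne γ) (by simpa using hne 0)
    (by
      intro m n hmn
      simp only [hmap] at hmn
      exact injective_iterate_of_infinite hpci (hinj hmn))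
    (by rwa [natDegree_map, natDegree_map])
  have hirr : ∀ n, Irreducible
      (quadIter (algebraMap k[X] (RatFunc k) γ) (algebraMap k[X] (RatFunc k) c) n) := by
    rintro (_ | n)
    · exact irreducible_X
    · exact hstable _ (by omega)
  refine ⟨2 ^ 2 ^ n₀, Nat.one_le_two_pow, fun n => ?_⟩
  rcases le_total n n₀ with h | h
  · exact (Nat.pow_le_pow_right (by norm_num) (Nat.pow_le_pow_right (by norm_num) h)).trans
      (Nat.le_mul_of_pos_right _ Module.finrank_pos)
  · induction n, h using Nat.le_induction with
    | base => exact Nat.le_mul_of_pos_right _ Module.finrank_pos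
    | succ n hn ih =>
      obtain ⟨r, hodd, hr⟩ := hn₀ (n + 1) (by omega)
      have h1 := two_pow_mul_finrank_splittingField_quadIter_le (hirr n) hodd hr
      calc 2 ^ 2 ^ (n + 1) = 2 ^ 2 ^ n * 2 ^ 2 ^ n := by rw [pow_succ, pow_mul, sq]
        _ ≤ 2 ^ 2 ^ n * (2 ^ 2 ^ n₀ * _) := Nat.mul_le_mul_left _ ih
        _ = 2 ^ 2 ^ n₀ * (2 ^ 2 ^ n * _) := Nat.mul_left_comm _ _ _
        _ ≤ _ := Nat.mul_le_mul_left _ h1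

end FiniteIndex

section BaseChange

theorem finrank_splittingField_le {K K' : Type*} [Field K] [Field K'] [Algebra K K']
    [FiniteDimensional K K'] (p : K[X]) :
    Module.finrank K p.SplittingField ≤ Module.finrank K K' *
      Module.finrank K' (p.map (algebraMap K K')).SplittingField := by
  set M := (p.map (algebraMap K K')).SplittingField
  have : FiniteDimensional K M := Module.Finite.trans K' M
  have hsplits : (p.map (algebraMap K M)).Splits := by
    rw [IsScalarTower.algebraMap_eq K K' M, ← Polynomial.map_map]
    exact SplittingField.splits _
  rw [Module.finrank_mul_finrank K K' M]
  exact (SplittingField.lift p hsplits).toLinearMap.finrank_le_finrank_of_injective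
    (SplittingField.lift p hsplits).injective

theorem natDegree_le_finrank_mul_natDegree_of_dvd_map {K K' : Type*} [Field K] [Field K']
    [Algebra K K'] [FiniteDimensional K K'] {p : K[X]} (hp : Irreducible p) {g : K'[X]}
    (hg : Irreducible g) (hdvd : g ∣ p.map (algebraMap K K')) :
    p.natDegree ≤ Module.finrank K K' * g.natDegree := by
  have : Fact (Irreducible g) := ⟨hg⟩
  set M := AdjoinRoot g
  have : FiniteDimensional K' M := (AdjoinRoot.powerBasis hg.ne_zero).finite
  have : FiniteDimensional K M := Module.Finite.trans K' M
  have hfin : Module.finrank K' M = g.natDegree := by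
    rw [(AdjoinRoot.powerBasis hg.ne_zero).finrank, AdjoinRoot.powerBasis_dim]
  have hroot : aeval (AdjoinRoot.root g) p = 0 := by
    rw [← aeval_map_algebraMap K']
    obtain ⟨q, hq⟩ := hdvd
    rw [hq, map_mul, AdjoinRoot.aeval_eq, AdjoinRoot.mk_self, zero_mul]
  rw [← hfin, Module.finrank_mul_finrank K K' M]
  have h1 := minpoly.eq_of_irreducible hp hroot
  have h2 := minpoly.natDegree_le (A := K) (AdjoinRoot.root g)
  rwa [← h1, natDegree_mul_C (inv_ne_zero (leadingCoeff_ne_zero.mpr hp.ne_zero))] at h2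

theorem card_factors_map_le_finrank {K K' : Type*} [Field K] [Field K'] [Algebra K K']
    [FiniteDimensional K K'] {p : K[X]} (hp : Irreducible p) :
    (UniqueFactorizationMonoid.factors (p.map (algebraMap K K'))).card ≤ Module.finrank K K' := by
  have hne : p.map (algebraMap K K') ≠ 0 :=
    (Polynomial.map_ne_zero_iff (algebraMap K K').injective).mpr hp.ne_zero
  set s := UniqueFactorizationMonoid.factors (p.map (algebraMap K K'))
  have hdeg : (s.map natDegree).sum = p.natDegree := by
    rw [← natDegree_multiset_prod _ fun h0 =>
        (UniqueFactorizationMonoid.irreducible_of_factor _ h0).ne_zero rfl,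
      natDegree_eq_of_degree_eq
        (degree_eq_degree_of_associated (UniqueFactorizationMonoid.factors_prod hne)),
      natDegree_map]
  have h1 : (s.map fun _ => p.natDegree).sum ≤
      (s.map fun g => Module.finrank K K' * g.natDegree).sum :=
    Multiset.sum_map_le_sum_map _ _ fun g hg =>
      natDegree_le_finrank_mul_natDegree_of_dvd_map hp
        (UniqueFactorizationMonoid.irreducible_of_factor g hg)
        (UniqueFactorizationMonoid.dvd_of_mem_factors hg)
  rw [Multiset.map_const', Multiset.sum_replicate, Multiset.sum_map_mul_left, hdeg,
    smul_eq_mul] at h1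
  exact Nat.le_of_mul_le_mul_right h1 hp.natDegree_pos

theorem exists_finrank_splittingField_le_and_card_factors_le {K K' : Type*} [Field K] [Field K']
    {σ : K →+* K'} (hσ : σ.Finite) :
    ∃ D, 1 ≤ D ∧ (∀ p : K[X], Module.finrank K p.SplittingField ≤
        D * Module.finrank K' (p.map σ).SplittingField) ∧
      ∀ p : K[X], Irreducible p → (UniqueFactorizationMonoid.factors (p.map σ)).card ≤ D := by
  let _ : Algebra K K' := σ.toAlgebra
  have : FiniteDimensional K K' := hσ
  exact ⟨Module.finrank K K', Module.finrank_pos, finrank_splittingField_le,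
    fun _ => card_factors_map_le_finrank⟩

theorem exists_finite_ringHom_ratFunc {k : Type*} [Field k] {f : RatFunc k}
    (hf : ∀ a : k, f ≠ algebraMap k (RatFunc k) a) :
    ∃ σ : RatFunc k →+* RatFunc k, σ.Finite ∧
      ∀ p : k[X], σ (algebraMap k[X] (RatFunc k) p) = aeval f p := by
  have hf' : ¬∃ a, f = RatFunc.C a := by
    rintro ⟨a, ha⟩
    exact hf a (by rw [ha, RatFunc.algebraMap_eq_C])
  obtain ⟨e, he⟩ : ∃ e : RatFunc k ≃ₐ[k] IntermediateField.adjoin k {f},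
      ∀ p : k[X], e (algebraMap k[X] (RatFunc k) p) =
        aeval (IntermediateField.AdjoinSimple.gen k f) p :=
    ⟨_, RatFunc.algEquivOfTranscendental_algebraMap f (RatFunc.transcendental_of_ne_C f hf')⟩
  have hfin : FiniteDimensional (IntermediateField.adjoin k {f}) (RatFunc k) := by
    have := IntermediateField.adjoin.finiteDimensional
      (RatFunc.isAlgebraic_adjoin_simple_X f hf').isIntegral
    rw [RatFunc.IntermediateField.adjoin_X] at this
    exact IntermediateField.topEquiv.toLinearEquiv.finiteDimensional
  refine ⟨(algebraMap (IntermediateField.adjoin k {f}) (RatFunc k)).comp e.toRingEquiv.toRingHom,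
    ?_, fun p => ?_⟩
  · exact RingHom.Finite.comp (RingHom.finite_algebraMap.mpr hfin)
      (RingHom.Finite.of_surjective _ e.surjective)
  · change algebraMap (IntermediateField.adjoin k {f}) (RatFunc k)
      (e (algebraMap k[X] (RatFunc k) p)) = _
    rw [he, ← aeval_algebraMap_apply]
    rfl

end BaseChange

/-- Corollary 1: if `φ = (x-γ)²+c` over `K = k(t)` is stable, post-critically infinite and
`h(φ) > 0`, then for any non-constant `f ∈ k(t)` the arboreal representation of
`φ_f(x) = (x - γ(f))² + c(f)` has finite index; in particular the number of irreducible
factors of `φ_f^n` is bounded independently of `n`. -/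
theorem finite_index_after_substitution (k : Type*) [Field k] [CharZero k] (γ c : Polynomial k)
    (φ : Polynomial (RatFunc k))
    (hφ : φ = (X - C (algebraMap (Polynomial k) (RatFunc k) γ)) ^ 2
            + C (algebraMap (Polynomial k) (RatFunc k) c))
    (hstable : ∀ n : ℕ, 1 ≤ n →
      Irreducible ((fun p => p.comp φ)^[n] (X : Polynomial (RatFunc k))))
    (hpci : Set.Infinite
      {x : Polynomial k | ∃ n : ℕ, 1 ≤ n ∧ (fun a => (a - γ) ^ 2 + c)^[n] γ = x})
    (hht : 0 < max γ.natDegree c.natDegree)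
    (f : RatFunc k) (hf : ∀ a : k, f ≠ algebraMap k (RatFunc k) a)
    (φf : Polynomial (RatFunc k))
    (hφf : φf = (X - C (Polynomial.aeval f γ)) ^ 2 + C (Polynomial.aeval f c)) :
    (∃ N : ℕ, 1 ≤ N ∧ ∀ n : ℕ, 1 ≤ n →
      2 ^ (2 ^ n - 1) ≤ N * Module.finrank (RatFunc k)
        (Polynomial.SplittingField ((fun p => p.comp φf)^[n] (X : Polynomial (RatFunc k))))) ∧
    (∃ B : ℕ, ∀ n : ℕ, 1 ≤ n →
      (UniqueFactorizationMonoid.factors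
        ((fun p => p.comp φf)^[n] (X : Polynomial (RatFunc k)))).card ≤ B) := by
  subst hφ hφf
  obtain ⟨σ, hσ, hσa⟩ := exists_finite_ringHom_ratFunc hf
  have hiter : ∀ n, (quadIter (algebraMap k[X] (RatFunc k) γ)
      (algebraMap k[X] (RatFunc k) c) n).map σ = quadIter (aeval f γ) (aeval f c) n := fun n => by
    rw [map_quadIter, hσa, hσa]
  obtain ⟨D, hD, hrank, hcard⟩ := exists_finrank_splittingField_le_and_card_factors_le hσ
  obtain ⟨N, hN, hle⟩ := exists_two_pow_le_mul_finrank_splittingField hstable hpci hht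
  refine ⟨⟨N * D, Nat.mul_pos hN hD, fun n _ => ?_⟩, D, fun n hn => ?_⟩
  · have h1 := hrank (quadIter (algebraMap k[X] (RatFunc k) γ) (algebraMap k[X] (RatFunc k) c) n)
    rw [hiter] at h1
    calc 2 ^ (2 ^ n - 1) ≤ 2 ^ 2 ^ n := Nat.pow_le_pow_right (by norm_num) (Nat.sub_le _ _)
      _ ≤ _ := hle n
      _ ≤ _ := Nat.mul_le_mul_left N h1
      _ = _ := (Nat.mul_assoc _ _ _).symm
  · have h1 := hcard _ (hstable n hn)
    change (UniqueFactorizationMonoid.factors (quadIter (aeval f γ) (aeval f c) n)).card ≤ D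
    rw [← hiter]
    exact h1
end
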